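/- Let n ≥ 1, 2 ≤ p < ∞, 0 < ε < 1 and k = [n/2]+1, and let q be the conjugate exponent, 1/p + 1/q = 1. Let a : 𝕋ⁿ × ℤⁿ → ℂ be a symbol, smooth in x, such that for all multi-indices α, β with |α|, |β| ≤ k there are constants C_α, C_β > 0 with |Δ_ξ^α a(x,ξ)| ≤ C_α ⟨ξ⟩^{−(n/2)ε − (1−ε)|α|} and |∂_x^β a(x,ξ)| ≤ C_β ⟨ξ⟩^{−(n/2)ε} for all (x,ξ) ∈ 𝕋ⁿ × ℤⁿ. Then for every r with q ≤ r ≤ p, the operator a(x,D) : L^p(𝕋ⁿ) → L^r(𝕋ⁿ) is bounded, i.e. there is C > 0 with ‖a(x,D)f‖_{L^r(𝕋ⁿ)} ≤ C ‖f‖_{L^p(𝕋ⁿ)} for all smooth f. -/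

import Mathlib

open MeasureTheory Real ENNReal

noncomputable section

/-- Partial derivative of a complex-valued function on `ℝⁿ` in the `j`-th coordinate
direction. -/
def pd {n : ℕ} (j : Fin n) (f : (Fin n → ℝ) → ℂ) : (Fin n → ℝ) → ℂ :=
  fun x => fderiv ℝ f x (Pi.single j 1)

/-- The canonical list of directions associated to a multi-index `β ∈ ℕⁿ`. -/
def mIdxList {n : ℕ} (β : Fin n → ℕ) : List (Fin n) :=
  (List.finRange n).flatMap fun j => List.replicate (β j) j

/-- Iterated partial derivative `∂^β` associated to a multi-index `β`. -/
def pdM {n : ℕ} (β : Fin n → ℕ) (f : (Fin n → ℝ) → ℂ) : (Fin n → ℝ) → ℂ :=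
  (mIdxList β).foldr pd f

/-- Forward difference operator in the `j`-th direction on functions of `ξ ∈ ℤⁿ`. -/
def dd {n : ℕ} (j : Fin n) (g : (Fin n → ℤ) → ℂ) : (Fin n → ℤ) → ℂ :=
  fun ξ => g (ξ + Pi.single j 1) - g ξ

/-- Iterated difference operator `Δ_ξ^α` associated to a multi-index `α`. -/
def ddM {n : ℕ} (α : Fin n → ℕ) (g : (Fin n → ℤ) → ℂ) : (Fin n → ℤ) → ℂ :=
  (mIdxList α).foldr dd g

/-- Japanese bracket `⟨ξ⟩ = (1+|ξ|²)^{1/2}` of a lattice point `ξ ∈ ℤⁿ`. -/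
def jb {n : ℕ} (ξ : Fin n → ℤ) : ℝ := Real.sqrt (1 + ∑ j, ((ξ j : ℝ)) ^ 2)

/-- Japanese bracket `⟨ξ⟩ = (1+|ξ|²)^{1/2}` of a vector `ξ ∈ ℝⁿ`. -/
def jbR {n : ℕ} (ξ : Fin n → ℝ) : ℝ := Real.sqrt (1 + ∑ j, (ξ j) ^ 2)

/-- The canonical embedding `ℤⁿ → ℝⁿ`. -/
def castZ {n : ℕ} (ξ : Fin n → ℤ) : Fin n → ℝ := fun j => (ξ j : ℝ)

/-- The fundamental domain `[0,1)ⁿ` of the torus `𝕋ⁿ = ℝⁿ/ℤⁿ`. -/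
def cube (n : ℕ) : Set (Fin n → ℝ) := Set.univ.pi fun _ => Set.Ico (0 : ℝ) 1

/-- The normalized Lebesgue measure of the torus `𝕋ⁿ`, realized as the Lebesgue measure
on `ℝⁿ` restricted to the fundamental domain `[0,1)ⁿ`. -/
def μT (n : ℕ) : Measure (Fin n → ℝ) := volume.restrict (cube n)

/-- `1`-periodicity of a function on `ℝⁿ` (i.e. the function descends to `𝕋ⁿ`). -/
def Per {n : ℕ} (f : (Fin n → ℝ) → ℂ) : Prop :=
  ∀ (x : Fin n → ℝ) (v : Fin n → ℤ), f (x + fun j => (v j : ℝ)) = f x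

/-- The character `e^{2πi⟨x,ξ⟩}`. -/
def eChar {n : ℕ} (x : Fin n → ℝ) (ξ : Fin n → ℤ) : ℂ :=
  Complex.exp (2 * (π : ℂ) * Complex.I * ∑ j, (x j : ℂ) * (ξ j : ℂ))

/-- Fourier coefficient `f̂(ξ) = ∫_{𝕋ⁿ} e^{-2πi⟨x,ξ⟩} f(x) dx` of a function on `𝕋ⁿ`. -/
def fc {n : ℕ} (f : (Fin n → ℝ) → ℂ) (ξ : Fin n → ℤ) : ℂ :=
  ∫ x, Complex.exp (-(2 * (π : ℂ) * Complex.I) * ∑ j, (x j : ℂ) * (ξ j : ℂ)) * f x ∂(μT n)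

/-- Periodic pseudo-differential operator
    `σ(x,D)f(x) = Σ_{ξ ∈ ℤⁿ} e^{2πi⟨x,ξ⟩} σ(x,ξ) f̂(ξ)`
with symbol `σ` on `𝕋ⁿ × ℤⁿ`. -/
def Op {n : ℕ} (σ : (Fin n → ℝ) → (Fin n → ℤ) → ℂ) (f : (Fin n → ℝ) → ℂ) :
    (Fin n → ℝ) → ℂ :=
  fun x => ∑' ξ : Fin n → ℤ, eChar x ξ * σ x ξ * fc f ξ

/-- The `L^p(𝕋ⁿ)` norm, for a real exponent `p`. -/
def lpT (n : ℕ) (p : ℝ) (g : (Fin n → ℝ) → ℂ) : ℝ :=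
  (∫ x, ‖g x‖ ^ p ∂(μT n)) ^ (1 / p)

/-- `∂_x^β Δ_ξ^α σ(x,ξ)` for a symbol `σ` on `𝕋ⁿ × ℤⁿ` (difference operator applied first,
then the derivatives in `x`). -/
def symbDxD {n : ℕ} (β α : Fin n → ℕ) (σ : (Fin n → ℝ) → (Fin n → ℤ) → ℂ)
    (x : Fin n → ℝ) (ξ : Fin n → ℤ) : ℂ :=
  pdM β (fun x' => ddM α (σ x') ξ) x

/-- `Δ_ξ^α ∂_x^β σ(x,ξ)` for a symbol `σ` on `𝕋ⁿ × ℤⁿ` (derivatives in `x` applied first,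
then the difference operator in `ξ`). -/
def symbDDx {n : ℕ} (α β : Fin n → ℕ) (σ : (Fin n → ℝ) → (Fin n → ℤ) → ℂ)
    (x : Fin n → ℝ) (ξ : Fin n → ℤ) : ℂ :=
  ddM α (fun ξ' => pdM β (fun x' => σ x' ξ') x) ξ

/-- `∂_ξ^α ∂_x^β σ(x,ξ)` for a symbol `σ` on `𝕋ⁿ × ℝⁿ` (derivatives in `x` applied first,
then the derivatives in `ξ`). -/
def symbDξDx {n : ℕ} (α β : Fin n → ℕ) (σ : (Fin n → ℝ) → (Fin n → ℝ) → ℂ)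
    (x ξ : Fin n → ℝ) : ℂ :=
  pdM α (fun ξ' => pdM β (fun x' => σ x' ξ') x) ξ

/-- `∂_x^β ∂_ξ^α σ(x,ξ)` for a symbol `σ` on `𝕋ⁿ × ℝⁿ` (derivatives in `ξ` applied first,
then the derivatives in `x`). -/
def symbDxDξ {n : ℕ} (β α : Fin n → ℕ) (σ : (Fin n → ℝ) → (Fin n → ℝ) → ℂ)
    (x ξ : Fin n → ℝ) : ℂ :=
  pdM β (fun x' => pdM α (σ x') ξ) x

/-- The Euclidean Fourier transform `û(ξ) = ∫_{ℝⁿ} e^{-2πi⟨x,ξ⟩} u(x) dx`. -/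
def FT {n : ℕ} (u : (Fin n → ℝ) → ℂ) (ξ : Fin n → ℝ) : ℂ :=
  ∫ x, Complex.exp (-(2 * (π : ℂ) * Complex.I) * ∑ j, (x j : ℂ) * (ξ j : ℂ)) * u x

/-- Pseudo-differential operator on `ℝⁿ`:
`T_σ u(x) = ∫_{ℝⁿ} e^{2πi⟨x,ξ⟩} σ(x,ξ) û(ξ) dξ`. -/
def OpR {n : ℕ} (σ : (Fin n → ℝ) → (Fin n → ℝ) → ℂ) (u : (Fin n → ℝ) → ℂ) :
    (Fin n → ℝ) → ℂ :=
  fun x => ∫ ξ, Complex.exp (2 * (π : ℂ) * Complex.I * ∑ j, (x j : ℂ) * (ξ j : ℂ)) * σ x ξ * FT u ξ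

/-- Periodic amplitude operator
`a(x,y,D)u(x) = ∫_{𝕋ⁿ} ∫_{ℝⁿ} e^{2πi⟨x-y,ξ⟩} a(x,y,ξ) u(y) dξ dy`. -/
def OpAmp {n : ℕ} (a : (Fin n → ℝ) → (Fin n → ℝ) → (Fin n → ℝ) → ℂ)
    (u : (Fin n → ℝ) → ℂ) : (Fin n → ℝ) → ℂ :=
  fun x => ∫ y,
    (∫ ξ, Complex.exp (2 * (π : ℂ) * Complex.I * ∑ j, ((x j : ℂ) - (y j : ℂ)) * (ξ j : ℂ)) *
        a x y ξ) * u y ∂(μT n)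

/-- The `L^p(ℝⁿ)` norm, for a real exponent `p`. -/
def lpR (n : ℕ) (p : ℝ) (g : (Fin n → ℝ) → ℂ) : ℝ :=
  (∫ x, ‖g x‖ ^ p) ^ (1 / p)

section Torus

variable {n : ℕ}

lemma cube_ae_eq_Icc (n : ℕ) : cube n =ᵐ[volume] Set.Icc (0 : Fin n → ℝ) 1 :=
  Measure.univ_pi_Ico_ae_eq_Icc (f := fun _ => (0 : ℝ)) (g := fun _ => (1 : ℝ))

lemma μT_eq_restrict_Icc (n : ℕ) : μT n = volume.restrict (Set.Icc (0 : Fin n → ℝ) 1) :=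
  Measure.restrict_congr_set (cube_ae_eq_Icc n)

lemma μT_eq_restrict_Ioc (n : ℕ) :
    μT n = volume.restrict {x : Fin n → ℝ | ∀ i, x i ∈ Set.Ioc (0 : ℝ) (0 + 1)} := by
  rw [μT_eq_restrict_Icc]
  refine Measure.restrict_congr_set ?_
  have h : {x : Fin n → ℝ | ∀ i, x i ∈ Set.Ioc (0 : ℝ) (0 + 1)}
      = Set.univ.pi fun _ => Set.Ioc (0 : ℝ) 1 := by
    ext x; simp
  rw [h]
  exact (Measure.univ_pi_Ioc_ae_eq_Icc (f := fun _ => (0 : ℝ)) (g := fun _ => (1 : ℝ))).symm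

instance isProbabilityMeasure_μT (n : ℕ) : IsProbabilityMeasure (μT n) := by
  constructor
  rw [μT, Measure.restrict_apply_univ, cube, Real.volume_pi_Ico]
  simp

lemma eChar_continuous_left (ξ : Fin n → ℤ) : Continuous fun x : Fin n → ℝ => eChar x ξ := by
  unfold eChar; fun_prop

lemma norm_eChar (x : Fin n → ℝ) (ξ : Fin n → ℤ) : ‖eChar x ξ‖ = 1 := by
  have h : 2 * (π : ℂ) * Complex.I * ∑ j, (x j : ℂ) * (ξ j : ℂ)
      = ((2 * π * ∑ j, x j * ξ j : ℝ) : ℂ) * Complex.I := by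
    push_cast; ring
  rw [eChar, h, Complex.norm_exp_ofReal_mul_I]

lemma eChar_add_right (x : Fin n → ℝ) (ξ η : Fin n → ℤ) :
    eChar x (ξ + η) = eChar x ξ * eChar x η := by
  simp only [eChar, ← Complex.exp_add, ← mul_add, ← Finset.sum_add_distrib, Pi.add_apply,
    Int.cast_add]

lemma eChar_zero_right (x : Fin n → ℝ) : eChar x 0 = 1 := by simp [eChar]

lemma eChar_neg_mul_self (x : Fin n → ℝ) (ξ : Fin n → ℤ) : eChar x (-ξ) * eChar x ξ = 1 := by
  rw [← eChar_add_right, neg_add_cancel, eChar_zero_right]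

lemma eChar_sub_left (x y : Fin n → ℝ) (ξ : Fin n → ℤ) :
    eChar (x - y) ξ = eChar x ξ * eChar y (-ξ) := by
  simp only [eChar, ← Complex.exp_add, ← mul_add, ← Finset.sum_add_distrib, Pi.sub_apply,
    Pi.neg_apply, Complex.ofReal_sub, Int.cast_neg]
  congr 2
  exact Finset.sum_congr rfl fun j _ => by ring

lemma star_eChar (x : Fin n → ℝ) (ξ : Fin n → ℤ) :
    (starRingEnd ℂ) (eChar x ξ) = eChar x (-ξ) := by
  simp [eChar, ← Complex.exp_conj, map_sum, map_ofNat]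

lemma eChar_per (ξ : Fin n → ℤ) : Per fun x : Fin n → ℝ => eChar x ξ := by
  intro x v
  have h : 2 * (π : ℂ) * Complex.I * ∑ j, ((x j + (v j : ℝ) : ℝ) : ℂ) * (ξ j : ℂ)
      = 2 * (π : ℂ) * Complex.I * ∑ j, (x j : ℂ) * (ξ j : ℂ)
        + ((∑ j, v j * ξ j : ℤ) : ℂ) * (2 * π * Complex.I) := by
    push_cast
    simp only [add_mul, Finset.sum_add_distrib]
    ring
  simp only [eChar, Pi.add_apply]
  rw [h, Complex.exp_add, Complex.exp_int_mul_two_pi_mul_I, mul_one]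

lemma fc_eq (f : (Fin n → ℝ) → ℂ) (ξ : Fin n → ℤ) :
    fc f ξ = ∫ x, eChar x (-ξ) * f x ∂(μT n) := by
  simp [fc, eChar]

lemma eChar_contDiff (ξ : Fin n → ℤ) : ContDiff ℝ (⊤ : ℕ∞) fun x : Fin n → ℝ => eChar x ξ := by
  unfold eChar
  have h : ∀ j : Fin n, ContDiff ℝ (⊤ : ℕ∞) fun x : Fin n → ℝ => ((x j : ℝ) : ℂ) := fun j =>
    Complex.ofRealCLM.contDiff.comp (contDiff_apply ℝ ℝ j)
  exact (contDiff_const.mul (ContDiff.sum fun j _ => (h j).mul contDiff_const)).cexp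

lemma pd_eChar (l : Fin n) (ξ : Fin n → ℤ) (x : Fin n → ℝ) :
    pd l (fun x => eChar x ξ) x = 2 * π * Complex.I * ξ l * eChar x ξ := by
  have h2 : ∀ j : Fin n, HasFDerivAt (fun x : Fin n → ℝ => (x j : ℂ))
      (Complex.ofRealCLM.comp (ContinuousLinearMap.proj j)) x := fun j =>
    (Complex.ofRealCLM.comp (ContinuousLinearMap.proj (R := ℝ) (φ := fun _ : Fin n => ℝ) j)).hasFDerivAt
  have h1 := ((HasFDerivAt.fun_sum (u := Finset.univ)
    fun j _ => (h2 j).mul_const (ξ j : ℂ)).const_mul (2 * (π : ℂ) * Complex.I)).cexp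
  rw [pd]
  unfold eChar
  rw [h1.fderiv]
  simp [Pi.single_apply, apply_ite (fun t : ℝ => (t : ℂ))]
  ring

lemma Per.pd {f : (Fin n → ℝ) → ℂ} (hf : Per f) (l : Fin n) : Per (pd l f) := by
  intro x v
  simp only [_root_.pd]
  have h : (fun y => f (y + fun j => (v j : ℝ))) = f := funext fun y => hf y v
  rw [← fderiv_comp_add_right, h]

lemma pd_contDiff {f : (Fin n → ℝ) → ℂ} (hf : ContDiff ℝ (⊤ : ℕ∞) f) (l : Fin n) :
    ContDiff ℝ (⊤ : ℕ∞) (pd l f) :=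
  (hf.fderiv_right (m := (⊤ : ℕ∞)) (by simp)).clm_apply contDiff_const

lemma Per.mul {f g : (Fin n → ℝ) → ℂ} (hf : Per f) (hg : Per g) : Per fun x => f x * g x :=
  fun x v => by simp only [hf x v, hg x v]

/-- A continuous periodic function is bounded. -/
lemma Per.exists_bound {f : (Fin n → ℝ) → ℂ} (hf : Per f) (hc : Continuous f) :
    ∃ B : ℝ, 0 < B ∧ ∀ x, ‖f x‖ ≤ B := by
  obtain ⟨B, hB⟩ := (isCompact_Icc (a := (0 : Fin n → ℝ)) (b := 1)).exists_bound_of_continuousOn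
    hc.continuousOn
  refine ⟨max B 1, by positivity, fun x => le_max_of_le_left ?_⟩
  have h := hf x (fun j => -⌊x j⌋)
  rw [← h]
  apply hB
  constructor <;> intro j
  · simpa using Int.floor_le (x j)
  · have := (Int.lt_floor_add_one (x j)).le
    simp only [Pi.add_apply, Int.cast_neg, Pi.one_apply]
    linarith

lemma integrable_of_continuous {E : Type*} [NormedAddCommGroup E] {f : (Fin n → ℝ) → E}
    (hf : Continuous f) : Integrable f (μT n) := by
  rw [μT_eq_restrict_Icc]
  exact (hf.continuousOn.integrableOn_compact isCompact_Icc)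

lemma integrable_of_bounded {f : (Fin n → ℝ) → ℂ} (hf : Measurable f) {B : ℝ}
    (hB : ∀ x, ‖f x‖ ≤ B) : Integrable f (μT n) :=
  Integrable.of_bound hf.aestronglyMeasurable B (.of_forall hB)

lemma integral_pd_eq_zero {g : (Fin n → ℝ) → ℂ} (hg : ContDiff ℝ (⊤ : ℕ∞) g) (hper : Per g)
    (l : Fin n) : ∫ x, pd l g x ∂(μT n) = 0 := by
  obtain ⟨m, rfl⟩ : ∃ m, n = m + 1 := Nat.exists_eq_succ_of_ne_zero (by
    rintro rfl; exact l.elim0)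
  rw [μT_eq_restrict_Icc]
  have hd : ∀ x, HasFDerivAt g (fderiv ℝ g x) x := fun x =>
    (hg.differentiable (by simp) x).hasFDerivAt
  have key := integral_divergence_of_hasFDerivAt_off_countable' (E := ℂ)
    (0 : Fin (m + 1) → ℝ) 1 zero_le_one
    (fun i => if i = l then g else 0) (fun i x => if i = l then fderiv ℝ g x else 0) ∅
    Set.countable_empty
    (fun i => by
      split_ifs
      · exact hg.continuous.continuousOn
      · exact continuousOn_const)
    (fun x _ i => by
      split_ifs
      · exact hd x
      · exact hasFDerivAt_const _ _)
  have hsum : ∀ x, ∑ i, (if i = l then fderiv ℝ g x else 0) (Pi.single i 1) = pd l g x := by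
    intro x
    rw [Finset.sum_eq_single l]
    · simp [pd]
    · intro b _ hb; simp [hb]
    · simp
  simp only [hsum] at key
  rw [key (((pd_contDiff hg l).continuous.continuousOn).integrableOn_compact isCompact_Icc)]
  refine Finset.sum_eq_zero fun i _ => ?_
  by_cases hi : i = l
  · simp only [hi, if_true]
    rw [sub_eq_zero]
    congr 1 with x
    have h := hper (l.insertNth (0 : ℝ) x) (Pi.single l 1)
    have h2 : (l.insertNth (0 : ℝ) x + fun j => (((Pi.single l 1 : Fin (m + 1) → ℤ) j : ℤ) : ℝ))
        = (l.insertNth (1 : ℝ) x : Fin (m + 1) → ℝ) := by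
      ext j
      refine Fin.succAboveCases l ?_ (fun j => ?_) j
      · simp
      · simp [Fin.succAbove_ne]
    rw [h2] at h
    exact h
  · simp [hi]

lemma integral_eChar (ξ : Fin n → ℤ) :
    ∫ x, eChar x ξ ∂(μT n) = if ξ = 0 then 1 else 0 := by
  split_ifs with h
  · simp [h, eChar_zero_right]
  · obtain ⟨l, hl⟩ := Function.ne_iff.1 h
    have h1 := integral_pd_eq_zero (eChar_contDiff ξ) (eChar_per ξ) l
    simp only [pd_eChar] at h1
    rw [integral_const_mul] at h1
    have hl' : (ξ l : ℂ) ≠ 0 := by exact_mod_cast hl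
    simpa [Real.pi_ne_zero, hl'] using h1

lemma fc_pd {f : (Fin n → ℝ) → ℂ} (hf : ContDiff ℝ (⊤ : ℕ∞) f) (hper : Per f) (l : Fin n)
    (ξ : Fin n → ℤ) : fc (pd l f) ξ = 2 * π * Complex.I * ξ l * fc f ξ := by
  have h := integral_pd_eq_zero ((eChar_contDiff (-ξ)).mul hf) ((eChar_per (-ξ)).mul hper) l
  have h1 : ∀ x, pd l (fun x => eChar x (-ξ) * f x) x
      = eChar x (-ξ) * pd l f x - 2 * π * Complex.I * ξ l * (eChar x (-ξ) * f x) := by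
    intro x
    have := pd_eChar l (-ξ) x
    simp only [pd] at this ⊢
    rw [fderiv_fun_mul ((eChar_contDiff (-ξ)).differentiable (by simp) x)
      (hf.differentiable (by simp) x)]
    simp only [add_apply, smul_apply, this, smul_eq_mul,
      Pi.neg_apply, Int.cast_neg]
    ring
  simp only [h1] at h
  rw [integral_sub, integral_const_mul, ← fc_eq, ← fc_eq, sub_eq_zero] at h
  · exact h
  · exact integrable_of_continuous ((eChar_continuous_left _).mul (pd_contDiff hf l).continuous)
  · exact integrable_of_continuous
      (continuous_const.mul ((eChar_continuous_left _).mul hf.continuous))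

lemma iterate_pd {f : (Fin n → ℝ) → ℂ} (hf : ContDiff ℝ (⊤ : ℕ∞) f) (hper : Per f) (l : Fin n)
    (k : ℕ) : ContDiff ℝ (⊤ : ℕ∞) ((pd l)^[k] f) ∧ Per ((pd l)^[k] f) ∧
      ∀ ξ, fc ((pd l)^[k] f) ξ = (2 * π * Complex.I * ξ l) ^ k * fc f ξ := by
  induction k with
  | zero => exact ⟨hf, hper, fun ξ => by simp⟩
  | succ k ih =>
    obtain ⟨h1, h2, h3⟩ := ih
    simp only [Function.iterate_succ_apply']
    exact ⟨pd_contDiff h1 l, h2.pd l, fun ξ => by rw [fc_pd h1 h2, h3]; ring⟩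

end Torus

section Fourier

variable {n : ℕ}

lemma lintegral_enorm_sq {f : (Fin n → ℝ) → ℂ} (hf : Integrable (fun x => ‖f x‖ ^ 2) (μT n)) :
    ∫⁻ x, ‖f x‖ₑ ^ 2 ∂(μT n) = ENNReal.ofReal (∫ x, ‖f x‖ ^ 2 ∂(μT n)) := by
  rw [ofReal_integral_eq_lintegral_ofReal hf (.of_forall fun x => by positivity)]
  refine lintegral_congr fun x => ?_
  rw [ENNReal.ofReal_pow (norm_nonneg _), ofReal_norm]

lemma trigPoly_continuous (F : Finset (Fin n → ℤ)) (c : (Fin n → ℤ) → ℂ) :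
    Continuous fun x : Fin n → ℝ => ∑ ξ ∈ F, c ξ * eChar x ξ :=
  continuous_finsetSum _ fun ξ _ => continuous_const.mul (eChar_continuous_left ξ)

lemma integral_eChar_mul_trigPoly (F : Finset (Fin n → ℤ)) (c : (Fin n → ℤ) → ℂ) (η : Fin n → ℤ) :
    ∫ x, eChar x (-η) * ∑ ξ ∈ F, c ξ * eChar x ξ ∂(μT n) = if η ∈ F then c η else 0 := by
  have h : ∀ x : Fin n → ℝ, eChar x (-η) * ∑ ξ ∈ F, c ξ * eChar x ξ
      = ∑ ξ ∈ F, c ξ * eChar x (ξ - η) := by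
    intro x
    rw [Finset.mul_sum]
    refine Finset.sum_congr rfl fun ξ _ => ?_
    rw [sub_eq_add_neg, eChar_add_right]; ring
  simp only [h]
  rw [integral_finsetSum]
  swap
  · exact fun ξ _ => integrable_of_continuous (continuous_const.mul (eChar_continuous_left _))
  simp only [integral_const_mul, integral_eChar, sub_eq_zero, mul_ite, mul_one, mul_zero,
    Finset.sum_ite_eq']

lemma integral_norm_sq_trigPoly (F : Finset (Fin n → ℤ)) (c : (Fin n → ℤ) → ℂ) :
    ∫ x, ‖∑ ξ ∈ F, c ξ * eChar x ξ‖ ^ 2 ∂(μT n) = ∑ ξ ∈ F, ‖c ξ‖ ^ 2 := by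
  apply Complex.ofReal_injective
  rw [← integral_complex_ofReal]
  have h : ∀ x : Fin n → ℝ, ((‖∑ ξ ∈ F, c ξ * eChar x ξ‖ ^ 2 : ℝ) : ℂ)
      = ∑ η ∈ F, (starRingEnd ℂ) (c η) * (eChar x (-η) * ∑ ξ ∈ F, c ξ * eChar x ξ) := by
    intro x
    rw [Complex.ofReal_pow, ← Complex.conj_mul', map_sum, Finset.sum_mul]
    exact Finset.sum_congr rfl fun η _ => by rw [map_mul, star_eChar]; ring
  simp only [h]
  rw [integral_finsetSum]
  swap
  · exact fun ξ _ => integrable_of_continuous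
      (continuous_const.mul ((eChar_continuous_left _).mul (trigPoly_continuous F c)))
  simp only [integral_const_mul, integral_eChar_mul_trigPoly]
  rw [Complex.ofReal_sum]
  refine Finset.sum_congr rfl fun ξ hξ => ?_
  rw [if_pos hξ, Complex.conj_mul', Complex.ofReal_pow]

/-- Parseval's identity for trigonometric polynomials. -/
lemma lintegral_enorm_sq_trigPoly (F : Finset (Fin n → ℤ)) (c : (Fin n → ℤ) → ℂ) :
    ∫⁻ x, ‖∑ ξ ∈ F, c ξ * eChar x ξ‖ₑ ^ 2 ∂(μT n) = ∑ ξ ∈ F, ‖c ξ‖ₑ ^ 2 := by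
  rw [lintegral_enorm_sq (integrable_of_continuous ((trigPoly_continuous F c).norm.pow 2)),
    integral_norm_sq_trigPoly, ENNReal.ofReal_sum_of_nonneg fun _ _ => by positivity]
  exact Finset.sum_congr rfl fun ξ _ => by rw [ENNReal.ofReal_pow (norm_nonneg _), ofReal_norm]

/-- Bessel's inequality. -/
lemma sum_norm_sq_fc_le {f : (Fin n → ℝ) → ℂ} (hf : Measurable f) {B : ℝ}
    (hB : ∀ x, ‖f x‖ ≤ B) (F : Finset (Fin n → ℤ)) :
    ∑ ξ ∈ F, ‖fc f ξ‖ ^ 2 ≤ ∫ x, ‖f x‖ ^ 2 ∂(μT n) := by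
  set P : (Fin n → ℝ) → ℂ := fun x => ∑ ξ ∈ F, fc f ξ * eChar x ξ with hP
  have hPc : Continuous P := trigPoly_continuous F _
  have hPi : Integrable (fun x => ‖P x‖ ^ 2) (μT n) :=
    integrable_of_continuous (hPc.norm.pow 2)
  have hfi : Integrable f (μT n) := integrable_of_bounded hf hB
  have hf2 : Integrable (fun x => ‖f x‖ ^ 2) (μT n) :=
    Integrable.of_bound (hf.norm.pow_const 2).aestronglyMeasurable (B ^ 2)
      (.of_forall fun x => by
        rw [Real.norm_of_nonneg (by positivity)]
        exact pow_le_pow_left₀ (norm_nonneg _) (hB x) 2)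
  have hei : ∀ ξ : Fin n → ℤ, Integrable (fun x => eChar x (-ξ) * f x) (μT n) := fun ξ =>
    hfi.bdd_mul (c := 1) (eChar_continuous_left _).aestronglyMeasurable
      (.of_forall fun x => (norm_eChar x _).le)
  have hc : ∀ x, (starRingEnd ℂ) (P x) * f x
      = ∑ ξ ∈ F, (starRingEnd ℂ) (fc f ξ) * (eChar x (-ξ) * f x) := by
    intro x
    rw [hP, map_sum, Finset.sum_mul]
    exact Finset.sum_congr rfl fun η _ => by rw [map_mul, star_eChar]; ring
  have hcross_int : Integrable (fun x => (starRingEnd ℂ) (P x) * f x) (μT n) := by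
    simp only [hc]
    exact integrable_finsetSum _ fun ξ _ => (hei ξ).const_mul _
  have hcross : ∫ x, (starRingEnd ℂ) (P x) * f x ∂(μT n) = ((∑ ξ ∈ F, ‖fc f ξ‖ ^ 2 : ℝ) : ℂ) := by
    simp only [hc]
    rw [integral_finsetSum _ fun ξ _ => (hei ξ).const_mul _, Complex.ofReal_sum]
    refine Finset.sum_congr rfl fun ξ _ => ?_
    rw [integral_const_mul, ← fc_eq, Complex.conj_mul', Complex.ofReal_pow]
  have hpt : ∀ x, 0 ≤ ‖f x‖ ^ 2 - 2 * ((starRingEnd ℂ) (P x) * f x).re + ‖P x‖ ^ 2 := by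
    intro x
    have h := sq_nonneg ‖f x - P x‖
    rw [Complex.sq_norm, Complex.normSq_sub, ← Complex.sq_norm, ← Complex.sq_norm, mul_comm (f x)] at h
    linarith
  have hint := integral_nonneg (μ := μT n) (f := fun x =>
    ‖f x‖ ^ 2 - 2 * ((starRingEnd ℂ) (P x) * f x).re + ‖P x‖ ^ 2) hpt
  have hre : Integrable (fun x => 2 * ((starRingEnd ℂ) (P x) * f x).re) (μT n) :=
    hcross_int.re.const_mul 2
  have hsub : Integrable (fun x => ‖f x‖ ^ 2 - 2 * ((starRingEnd ℂ) (P x) * f x).re) (μT n) :=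
    hf2.sub hre
  rw [integral_add hsub hPi, integral_sub hf2 hre, integral_const_mul,
    integral_norm_sq_trigPoly] at hint
  have hre2 : ∫ x, ((starRingEnd ℂ) (P x) * f x).re ∂(μT n) = ∑ ξ ∈ F, ‖fc f ξ‖ ^ 2 := by
    have := integral_re hcross_int
    simp only [RCLike.re_to_complex] at this
    rw [this, hcross, Complex.ofReal_re]
  rw [hre2] at hint
  linarith

lemma sum_enorm_sq_fc_le {f : (Fin n → ℝ) → ℂ} (hf : Measurable f) {B : ℝ}
    (hB : ∀ x, ‖f x‖ ≤ B) (F : Finset (Fin n → ℤ)) :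
    ∑ ξ ∈ F, ‖fc f ξ‖ₑ ^ 2 ≤ ∫⁻ x, ‖f x‖ₑ ^ 2 ∂(μT n) := by
  have hf2 : Integrable (fun x => ‖f x‖ ^ 2) (μT n) :=
    Integrable.of_bound (hf.norm.pow_const 2).aestronglyMeasurable (B ^ 2)
      (.of_forall fun x => by
        rw [Real.norm_of_nonneg (by positivity)]
        exact pow_le_pow_left₀ (norm_nonneg _) (hB x) 2)
  rw [lintegral_enorm_sq hf2]
  refine le_trans (le_of_eq ?_) (ENNReal.ofReal_le_ofReal (sum_norm_sq_fc_le hf hB F))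
  rw [ENNReal.ofReal_sum_of_nonneg fun _ _ => by positivity]
  exact Finset.sum_congr rfl fun ξ _ => by rw [ENNReal.ofReal_pow (norm_nonneg _), ofReal_norm]

/-- Pointwise Fourier inversion for a continuous periodic function with absolutely convergent
Fourier series. -/
lemma hasSum_fc_mul_eChar {b : (Fin n → ℝ) → ℂ} (hb : Continuous b) (hper : Per b)
    (hs : Summable (fc b)) (x : Fin n → ℝ) : HasSum (fun ξ => fc b ξ * eChar x ξ) (b x) := by
  have hq : IsOpenQuotientMap (Pi.map fun (_ : Fin n) (t : ℝ) => (t : UnitAddCircle)) :=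
    IsOpenQuotientMap.piMap fun _ => QuotientAddGroup.isOpenQuotientMap_mk
  let q : C(Fin n → ℝ, UnitAddTorus (Fin n)) := ⟨_, hq.continuous⟩
  have hq' : Topology.IsQuotientMap q := hq.isQuotientMap
  have hfac : Function.FactorsThrough (⟨b, hb⟩ : C(Fin n → ℝ, ℂ)) q := by
    intro y z hyz
    have h : ∀ i, ∃ m : ℤ, z i = y i + m := by
      intro i
      have hi : ((y i : ℝ) : UnitAddCircle) = (z i : ℝ) := congrFun hyz i
      obtain ⟨m, hm⟩ := AddSubgroup.mem_zmultiples_iff.1 (QuotientAddGroup.eq.1 hi)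
      refine ⟨m, ?_⟩
      simp at hm
      linarith
    choose m hm using h
    have : z = y + fun j => (m j : ℝ) := funext hm
    change b y = b z
    rw [this, hper]
  let g : C(UnitAddTorus (Fin n), ℂ) := hq'.lift ⟨b, hb⟩ hfac
  have hg : ∀ y, g (q y) = b y := fun y => by
    have := congrArg (fun f : C(Fin n → ℝ, ℂ) => f y) (hq'.lift_comp ⟨b, hb⟩ hfac)
    exact this
  have hm : ∀ (y : Fin n → ℝ) (ξ : Fin n → ℤ), UnitAddTorus.mFourier ξ (q y) = eChar y ξ := by
    intro y ξ
    change ∏ i, fourier (ξ i) ((y i : ℝ) : UnitAddCircle) = _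
    simp only [fourier_coe_apply, eChar, ← Complex.exp_sum, Finset.mul_sum]
    congr 1
    exact Finset.sum_congr rfl fun i _ => by push_cast; ring
  have hcoeff : ∀ ξ, UnitAddTorus.mFourierCoeff g ξ = fc b ξ := by
    intro ξ
    rw [UnitAddTorus.mFourierCoeff_eq_integral g ξ 0, fc_eq, μT_eq_restrict_Ioc]
    refine integral_congr_ae (.of_forall fun y => ?_)
    have h1 := hm y (-ξ)
    have h2 := hg y
    simp only [smul_eq_mul, ← h1, ← h2]
    rfl
  have hs' : Summable (UnitAddTorus.mFourierCoeff g) := by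
    rwa [show UnitAddTorus.mFourierCoeff g = fc b from funext hcoeff]
  have := UnitAddTorus.hasSum_mFourier_series_apply_of_summable hs' (q x)
  simpa only [hcoeff, hm, hg, smul_eq_mul] using this

end Fourier

section SquareIntegrable

variable {n : ℕ}

lemma summable_inv_one_add_sum_pow {k : ℕ} (hk : n < 2 * k) :
    Summable fun η : Fin n → ℤ => (1 + ∑ l, |(η l : ℝ)| ^ (2 * k))⁻¹ := by
  let L : Submodule ℤ (Fin n → ℝ) := Submodule.span ℤ (Set.range (Pi.basisFun ℝ (Fin n)))
  have hrank : Module.finrank ℤ L = n := by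
    rw [ZLattice.rank ℝ L, Module.finrank_fin_fun]
  have hmem : ∀ η : Fin n → ℤ, castZ η ∈ L := by
    intro η
    have : castZ η = ∑ i, η i • Pi.basisFun ℝ (Fin n) i := by
      ext j
      simp [castZ, Pi.single_apply]
    rw [this]
    exact Submodule.sum_mem _ fun i _ => Submodule.smul_mem _ _ (Submodule.subset_span ⟨i, rfl⟩)
  let φ : (Fin n → ℤ) → L := fun η => ⟨castZ η, hmem η⟩
  have hφ : Function.Injective φ := by
    intro η ζ h
    have h' : castZ η = castZ ζ := congrArg Subtype.val h
    funext j
    simpa [castZ] using congrFun h' j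
  have hs := (ZLattice.summable_norm_rpow L (-(2 * k : ℕ)) (by
    rw [hrank, neg_lt_neg_iff]; exact_mod_cast hk)).comp_injective hφ
  refine hs.of_norm_bounded_eventually ?_
  refine Filter.eventually_cofinite.2 ((Set.finite_singleton (0 : Fin n → ℤ)).subset ?_)
  intro η hη
  by_contra h0
  apply hη
  have hnorm : 0 < ‖castZ η‖ := by
    rw [norm_pos_iff]
    intro h
    exact h0 (funext fun j => by simpa [castZ] using congrFun h j)
  have hpos : 0 ≤ ∑ l, |(η l : ℝ)| ^ (2 * k) := Finset.sum_nonneg fun _ _ => by positivity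
  rw [Real.norm_of_nonneg (by positivity)]
  change _ ≤ ‖castZ η‖ ^ (-((2 * k : ℕ) : ℝ))
  rw [Real.rpow_neg hnorm.le, Real.rpow_natCast]
  apply inv_anti₀ (by positivity)
  have : Nonempty (Fin n) := by
    by_contra h
    exact h0 (funext fun j => (h ⟨j⟩).elim)
  obtain ⟨i, hi⟩ := Finite.exists_max (fun j => ‖castZ η j‖)
  have hle : ‖castZ η‖ ≤ |(η i : ℝ)| := (pi_norm_le_iff_of_nonneg (by positivity)).2 hi
  have h1 := Finset.single_le_sum (f := fun l => |(η l : ℝ)| ^ (2 * k))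
    (fun _ _ => by positivity) (Finset.mem_univ i)
  have h2 := pow_le_pow_left₀ hnorm.le hle (2 * k)
  linarith

/-- Sobolev's inequality on the torus, using only the pure derivatives of order `k > n / 2`. -/
lemma exists_sobolev_const {k : ℕ} (hk : n < 2 * k) :
    ∃ C : ℝ≥0∞, C ≠ ⊤ ∧ ∀ b : (Fin n → ℝ) → ℂ, ContDiff ℝ (⊤ : ℕ∞) b → Per b → ∀ x,
      ‖b x‖ₑ ^ 2 ≤ C * (∫⁻ y, ‖b y‖ₑ ^ 2 ∂(μT n) + ∑ l, ∫⁻ y, ‖(pd l)^[k] b y‖ₑ ^ 2 ∂(μT n)) := by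
  have hsum := summable_inv_one_add_sum_pow hk
  set w : (Fin n → ℤ) → ℝ := fun η => 1 + ∑ l, |(η l : ℝ)| ^ (2 * k) with hw
  have hwpos : ∀ η, 0 < w η := fun η =>
    add_pos_of_pos_of_nonneg one_pos (Finset.sum_nonneg fun _ _ => by positivity)
  set S : ℝ := ∑' η, (w η)⁻¹
  refine ⟨ENNReal.ofReal S, ENNReal.ofReal_ne_top, fun b hb hper x => ?_⟩
  have hit := fun l => iterate_pd hb hper l k
  have hsq : ∀ {g : (Fin n → ℝ) → ℂ}, ContDiff ℝ (⊤ : ℕ∞) g →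
      Integrable (fun x => ‖g x‖ ^ 2) (μT n) := fun hg =>
    integrable_of_continuous (hg.continuous.norm.pow 2)
  set R : ℝ := ∫ y, ‖b y‖ ^ 2 ∂(μT n) + ∑ l, ∫ y, ‖(pd l)^[k] b y‖ ^ 2 ∂(μT n) with hR
  have hI : ∀ g : (Fin n → ℝ) → ℂ, 0 ≤ ∫ y, ‖g y‖ ^ 2 ∂(μT n) := fun g =>
    integral_nonneg fun y => by positivity
  have hRnn : 0 ≤ R := add_nonneg (hI _) (Finset.sum_nonneg fun l _ => hI _)
  have hbessel : ∀ {g : (Fin n → ℝ) → ℂ}, ContDiff ℝ (⊤ : ℕ∞) g → Per g →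
      ∀ F : Finset (Fin n → ℤ), ∑ ξ ∈ F, ‖fc g ξ‖ ^ 2 ≤ ∫ x, ‖g x‖ ^ 2 ∂(μT n) := by
    intro g hg hp F
    obtain ⟨B, -, hB⟩ := hp.exists_bound hg.continuous
    exact sum_norm_sq_fc_le hg.continuous.measurable hB F
  have hterm : ∀ (l : Fin n) (ξ : Fin n → ℤ),
      |(ξ l : ℝ)| ^ (2 * k) * ‖fc b ξ‖ ^ 2 ≤ ‖fc ((pd l)^[k] b) ξ‖ ^ 2 := by
    intro l ξ
    rw [(hit l).2.2 ξ, norm_mul, mul_pow, norm_pow, ← pow_mul, mul_comm k 2]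
    refine mul_le_mul_of_nonneg_right (pow_le_pow_left₀ (abs_nonneg _) ?_ _) (by positivity)
    have h1 : ‖2 * (π : ℂ) * Complex.I * (ξ l : ℂ)‖ = 2 * π * |(ξ l : ℝ)| := by
      simp [abs_of_pos Real.pi_pos]
    rw [h1]
    have := Real.pi_gt_three
    nlinarith [abs_nonneg (ξ l : ℝ)]
  have hwsum : ∀ F : Finset (Fin n → ℤ), ∑ ξ ∈ F, w ξ * ‖fc b ξ‖ ^ 2 ≤ R := by
    intro F
    have h1 : ∀ ξ, w ξ * ‖fc b ξ‖ ^ 2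
        = ‖fc b ξ‖ ^ 2 + ∑ l, |(ξ l : ℝ)| ^ (2 * k) * ‖fc b ξ‖ ^ 2 := by
      intro ξ; rw [hw, add_mul, one_mul, Finset.sum_mul]
    simp only [h1]
    rw [Finset.sum_add_distrib, Finset.sum_comm]
    refine add_le_add (hbessel hb hper F) (Finset.sum_le_sum fun l _ => ?_)
    exact (Finset.sum_le_sum fun ξ _ => hterm l ξ).trans (hbessel (hit l).1 (hit l).2.1 F)
  have hcs : ∀ F : Finset (Fin n → ℤ), ∑ ξ ∈ F, ‖fc b ξ‖ ≤ √(S * R) := by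
    intro F
    apply Real.le_sqrt_of_sq_le
    have h1 := Finset.sum_mul_sq_le_sq_mul_sq F (fun ξ => √(w ξ)⁻¹) (fun ξ => √(w ξ) * ‖fc b ξ‖)
    have h2 : ∀ ξ, √(w ξ)⁻¹ * (√(w ξ) * ‖fc b ξ‖) = ‖fc b ξ‖ := by
      intro ξ
      rw [← mul_assoc, ← Real.sqrt_mul (inv_nonneg.2 (hwpos ξ).le),
        inv_mul_cancel₀ (hwpos ξ).ne', Real.sqrt_one, one_mul]
    have h3 : ∀ ξ, √(w ξ)⁻¹ ^ 2 = (w ξ)⁻¹ := fun ξ => Real.sq_sqrt (inv_nonneg.2 (hwpos ξ).le)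
    have h4 : ∀ ξ, (√(w ξ) * ‖fc b ξ‖) ^ 2 = w ξ * ‖fc b ξ‖ ^ 2 := fun ξ => by
      rw [mul_pow, Real.sq_sqrt (hwpos ξ).le]
    simp only [h2, h3, h4] at h1
    refine h1.trans (mul_le_mul ?_ (hwsum F) ?_ ?_)
    · exact hsum.sum_le_tsum F fun ξ _ => inv_nonneg.2 (hwpos ξ).le
    · exact Finset.sum_nonneg fun ξ _ => mul_nonneg (hwpos ξ).le (by positivity)
    · exact tsum_nonneg fun ξ => inv_nonneg.2 (hwpos ξ).le
  have hSnn : 0 ≤ S := tsum_nonneg fun ξ => inv_nonneg.2 (hwpos ξ).le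
  have hsn : Summable fun ξ => ‖fc b ξ‖ := summable_of_sum_le (fun _ => norm_nonneg _) hcs
  have hfin : ‖b x‖ ^ 2 ≤ S * R := by
    have h := hasSum_fc_mul_eChar hb.continuous hper hsn.of_norm x
    have h1 : ‖b x‖ ≤ √(S * R) := by
      rw [← h.tsum_eq]
      refine (norm_tsum_le_tsum_norm ?_).trans ?_
      · simpa [norm_eChar] using hsn
      · simp only [norm_mul, norm_eChar, mul_one]
        exact hsn.tsum_le_of_sum_le hcs
    calc ‖b x‖ ^ 2 ≤ √(S * R) ^ 2 := pow_le_pow_left₀ (norm_nonneg _) h1 2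
      _ = S * R := Real.sq_sqrt (mul_nonneg hSnn hRnn)
  rw [lintegral_enorm_sq (hsq hb)]
  simp only [fun l => lintegral_enorm_sq (hsq (hit l).1)]
  rw [← ENNReal.ofReal_sum_of_nonneg fun l _ => hI _, ← ENNReal.ofReal_add (hI _)
    (Finset.sum_nonneg fun l _ => hI _), ← ENNReal.ofReal_mul hSnn, ← ofReal_norm,
    ← ENNReal.ofReal_pow (norm_nonneg _)]
  exact ENNReal.ofReal_le_ofReal hfin

/-- The pseudo-differential operator with symbol `s` cut off to a finite set of frequencies. -/
def finOp (F : Finset (Fin n → ℤ)) (s : (Fin n → ℝ) → (Fin n → ℤ) → ℂ) (f : (Fin n → ℝ) → ℂ)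
    (x : Fin n → ℝ) : ℂ :=
  ∑ ξ ∈ F, eChar x ξ * s x ξ * fc f ξ

lemma iterate_pd_sum (F : Finset (Fin n → ℤ)) (c : (Fin n → ℤ) → ℂ)
    {s : (Fin n → ℝ) → (Fin n → ℤ) → ℂ} (hs : ∀ ξ, ContDiff ℝ (⊤ : ℕ∞) fun x => s x ξ)
    (hper : ∀ ξ, Per fun x => s x ξ) (l : Fin n) (k : ℕ) :
    (pd l)^[k] (fun y => ∑ ξ ∈ F, c ξ * s y ξ)
      = fun y => ∑ ξ ∈ F, c ξ * (pd l)^[k] (fun x => s x ξ) y := by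
  induction k with
  | zero => rfl
  | succ k ih =>
    simp only [Function.iterate_succ_apply', ih]
    funext y
    have h : ∀ ξ, DifferentiableAt ℝ ((pd l)^[k] fun x => s x ξ) y := fun ξ =>
      (iterate_pd (hs ξ) (hper ξ) l k).1.differentiable (by simp) y
    simp only [pd]
    rw [fderiv_fun_sum fun ξ _ => (h ξ).const_mul _, sum_apply]
    refine Finset.sum_congr rfl fun ξ _ => ?_
    rw [fderiv_const_mul (h ξ), smul_apply, smul_eq_mul]

lemma lintegral_lintegral_enorm_sq_le (F : Finset (Fin n → ℤ))
    {t : (Fin n → ℝ) → (Fin n → ℤ) → ℂ} (ht : ∀ ξ, Continuous fun y => t y ξ) {N : ℝ≥0∞}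
    (hN : ∀ y, ∀ ξ, ‖t y ξ‖ₑ ≤ N) {f : (Fin n → ℝ) → ℂ} (hf : Measurable f) {B : ℝ}
    (hB : ∀ x, ‖f x‖ ≤ B) :
    ∫⁻ x, ∫⁻ y, ‖∑ ξ ∈ F, eChar x ξ * fc f ξ * t y ξ‖ₑ ^ 2 ∂(μT n) ∂(μT n)
      ≤ N ^ 2 * ∫⁻ x, ‖f x‖ₑ ^ 2 ∂(μT n) := by
  rw [lintegral_lintegral_swap]
  · have h1 : ∀ y, ∫⁻ x, ‖∑ ξ ∈ F, eChar x ξ * fc f ξ * t y ξ‖ₑ ^ 2 ∂(μT n)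
        ≤ N ^ 2 * ∫⁻ x, ‖f x‖ₑ ^ 2 ∂(μT n) := by
      intro y
      have h2 : ∀ x : Fin n → ℝ, ∑ ξ ∈ F, eChar x ξ * fc f ξ * t y ξ
          = ∑ ξ ∈ F, (fc f ξ * t y ξ) * eChar x ξ := fun x =>
        Finset.sum_congr rfl fun ξ _ => by ring
      simp only [h2]
      rw [lintegral_enorm_sq_trigPoly]
      calc ∑ ξ ∈ F, ‖fc f ξ * t y ξ‖ₑ ^ 2 ≤ ∑ ξ ∈ F, N ^ 2 * ‖fc f ξ‖ₑ ^ 2 := by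
            refine Finset.sum_le_sum fun ξ _ => ?_
            rw [enorm_mul, mul_pow, mul_comm]
            gcongr
            exact hN y ξ
        _ = N ^ 2 * ∑ ξ ∈ F, ‖fc f ξ‖ₑ ^ 2 := by rw [Finset.mul_sum]
        _ ≤ _ := by gcongr; exact sum_enorm_sq_fc_le hf hB F
    refine (lintegral_mono h1).trans ?_
    simp
  · have hc : Continuous fun z : (Fin n → ℝ) × (Fin n → ℝ) =>
        ∑ ξ ∈ F, eChar z.1 ξ * fc f ξ * t z.2 ξ :=
      continuous_finsetSum _ fun ξ _ => (((eChar_continuous_left ξ).comp continuous_fst).mul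
        continuous_const).mul ((ht ξ).comp continuous_snd)
    exact (hc.measurable.enorm.pow_const 2).aemeasurable

/-- `L²` bound for pseudo-differential operators whose symbol has bounded `x`-derivatives of order
`k > n / 2`. -/
lemma exists_lintegral_finOp_sq_le {k : ℕ} (hk : n < 2 * k) :
    ∃ C : ℝ≥0∞, C ≠ ⊤ ∧ ∀ (F : Finset (Fin n → ℤ)) (s : (Fin n → ℝ) → (Fin n → ℤ) → ℂ)
      (N : ℝ≥0∞), (∀ ξ, ContDiff ℝ (⊤ : ℕ∞) fun x => s x ξ) → (∀ ξ, Per fun x => s x ξ) →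
      (∀ x ξ, ‖s x ξ‖ₑ ≤ N) → (∀ l x ξ, ‖(pd l)^[k] (fun x => s x ξ) x‖ₑ ≤ N) →
      ∀ (f : (Fin n → ℝ) → ℂ) (B : ℝ), Measurable f → (∀ x, ‖f x‖ ≤ B) →
        ∫⁻ x, ‖finOp F s f x‖ₑ ^ 2 ∂(μT n) ≤ C * N ^ 2 * ∫⁻ x, ‖f x‖ₑ ^ 2 ∂(μT n) := by
  obtain ⟨C, hC, hsob⟩ := exists_sobolev_const hk
  refine ⟨C * (1 + n), ENNReal.mul_ne_top hC (by finiteness), ?_⟩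
  intro F s N hs hper hN hN' f B hf hB
  set c : (Fin n → ℝ) → (Fin n → ℤ) → ℂ := fun x ξ => eChar x ξ * fc f ξ with hc
  have hb : ∀ x, ContDiff ℝ (⊤ : ℕ∞) fun y => ∑ ξ ∈ F, c x ξ * s y ξ := fun x =>
    ContDiff.sum fun ξ _ => contDiff_const.mul (hs ξ)
  have hbp : ∀ x, Per fun y => ∑ ξ ∈ F, c x ξ * s y ξ := fun x y v =>
    Finset.sum_congr rfl fun ξ _ => congrArg (c x ξ * ·) (hper ξ y v)
  have hmeas : ∀ t : (Fin n → ℝ) → (Fin n → ℤ) → ℂ, (∀ ξ, Continuous fun y => t y ξ) →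
      Measurable fun x => ∫⁻ y, ‖∑ ξ ∈ F, c x ξ * t y ξ‖ₑ ^ 2 ∂(μT n) := by
    intro t ht
    have h : Continuous fun z : (Fin n → ℝ) × (Fin n → ℝ) => ∑ ξ ∈ F, c z.1 ξ * t z.2 ξ :=
      continuous_finsetSum _ fun ξ _ => (((eChar_continuous_left ξ).comp continuous_fst).mul
        continuous_const).mul ((ht ξ).comp continuous_snd)
    exact (h.measurable.enorm.pow_const 2).lintegral_prod_right'
  calc ∫⁻ x, ‖finOp F s f x‖ₑ ^ 2 ∂(μT n)
      ≤ ∫⁻ x, C * (∫⁻ y, ‖∑ ξ ∈ F, c x ξ * s y ξ‖ₑ ^ 2 ∂(μT n)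
        + ∑ l, ∫⁻ y, ‖∑ ξ ∈ F, c x ξ * (pd l)^[k] (fun x => s x ξ) y‖ₑ ^ 2 ∂(μT n)) ∂(μT n) := by
        refine lintegral_mono fun x => ?_
        have h := hsob _ (hb x) (hbp x) x
        simp only [fun l => iterate_pd_sum F (c x) hs hper l k] at h
        refine le_trans (le_of_eq ?_) h
        congr 2
        exact Finset.sum_congr rfl fun ξ _ => by rw [hc]; ring
    _ ≤ C * (N ^ 2 * ∫⁻ x, ‖f x‖ₑ ^ 2 ∂(μT n)
        + ∑ _l : Fin n, N ^ 2 * ∫⁻ x, ‖f x‖ₑ ^ 2 ∂(μT n)) := by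
        rw [lintegral_const_mul' _ _ hC, lintegral_add_left (hmeas s fun ξ => (hs ξ).continuous),
          lintegral_finsetSum _ fun l _ => hmeas _ fun ξ =>
            (iterate_pd (hs ξ) (hper ξ) l k).1.continuous]
        gcongr with l
        · exact lintegral_lintegral_enorm_sq_le F (fun ξ => (hs ξ).continuous) hN hf hB
        · exact lintegral_lintegral_enorm_sq_le F
            (t := fun y ξ => (pd l)^[k] (fun x => s x ξ) y)
            (fun ξ => (iterate_pd (hs ξ) (hper ξ) l k).1.continuous) (hN' l) hf hB
    _ = C * (1 + n) * N ^ 2 * ∫⁻ x, ‖f x‖ₑ ^ 2 ∂(μT n) := by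
        rw [Finset.sum_const, Finset.card_univ, Fintype.card_fin, nsmul_eq_mul]
        ring

end SquareIntegrable

section Kernel

variable {n : ℕ}

lemma exists_integral_sin_weight_le {s : ℝ} (hs : 1 < s) :
    ∃ C : ℝ, 0 ≤ C ∧ ∀ b : ℝ, 0 < b → ∀ x : ℝ,
      ∫ t in (0 : ℝ)..1, ((1 + b * |2 * sin (π * (x - t))|) / 2) ^ (-s) ≤ C / b := by
  have hint : Integrable fun v : ℝ => (1 + ‖v‖) ^ (-s) :=
    integrable_one_add_norm (by simpa using hs)
  set I : ℝ := ∫ v : ℝ, (1 + ‖v‖) ^ (-s)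
  have hI : 0 ≤ I := integral_nonneg fun v => by positivity
  refine ⟨2 ^ s * I, by positivity, fun b hb x => ?_⟩
  set h : ℝ → ℝ := fun u => ((1 + b * |2 * sin (π * u)|) / 2) ^ (-s) with hh
  have hper : Function.Periodic h 1 := by
    intro u
    simp only [hh, mul_add, mul_one, sin_add_pi, mul_neg, abs_neg]
  have hcont : Continuous h := by
    refine Continuous.rpow_const (by fun_prop) fun u => Or.inl ?_
    positivity
  have h1 : ∫ t in (0 : ℝ)..1, h (x - t) = ∫ u in (-1 / 2 : ℝ)..1 / 2, h u := by
    rw [intervalIntegral.integral_comp_sub_left]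
    have := hper.intervalIntegral_add_eq (x - 1) (-1 / 2)
    norm_num at this ⊢
    exact this
  change ∫ t in (0 : ℝ)..1, h (x - t) ≤ _
  have hcomp : Integrable fun u : ℝ => (2 : ℝ) ^ s * (1 + ‖b * u‖) ^ (-s) :=
    (hint.comp_mul_left' hb.ne').const_mul _
  rw [h1]
  calc ∫ u in (-1 / 2 : ℝ)..1 / 2, h u
      ≤ ∫ u in (-1 / 2 : ℝ)..1 / 2, (2 : ℝ) ^ s * (1 + ‖b * u‖) ^ (-s) := by
        refine intervalIntegral.integral_mono_on (by norm_num) (hcont.intervalIntegrable _ _)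
          hcomp.intervalIntegrable fun u hu => ?_
        have hu' : |u| ≤ 1 / 2 := abs_le.2 ⟨by linarith [hu.1], hu.2⟩
        have hsin := mul_abs_le_abs_sin (x := π * u) (by
          rw [abs_mul, abs_of_pos pi_pos]; nlinarith [pi_pos])
        rw [abs_mul, abs_of_pos pi_pos, ← mul_assoc, div_mul_cancel₀ _ pi_pos.ne'] at hsin
        have h2 : (1 + ‖b * u‖) / 2 ≤ (1 + b * |2 * sin (π * u)|) / 2 := by
          rw [norm_mul, Real.norm_of_nonneg hb.le, Real.norm_eq_abs, abs_mul, abs_two]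
          gcongr
          linarith [abs_nonneg u]
        calc h u ≤ ((1 + ‖b * u‖) / 2) ^ (-s) :=
              Real.rpow_le_rpow_of_nonpos (by positivity) h2 (by linarith)
          _ = 2 ^ s * (1 + ‖b * u‖) ^ (-s) := by
              rw [Real.div_rpow (by positivity) (by norm_num), Real.rpow_neg zero_le_two s,
                div_inv_eq_mul, mul_comm]
    _ ≤ ∫ u : ℝ, (2 : ℝ) ^ s * (1 + ‖b * u‖) ^ (-s) := by
        rw [intervalIntegral.integral_of_le (by norm_num)]
        exact setIntegral_le_integral hcomp (.of_forall fun u => by positivity)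
    _ = 2 ^ s * I / b := by
        rw [integral_const_mul,
          Measure.integral_comp_mul_left (fun v : ℝ => (1 + ‖v‖) ^ (-s)) b]
        rw [abs_of_pos (by positivity), smul_eq_mul]
        field_simp
        rfl

lemma integral_prod_μT (h : Fin n → ℝ → ℝ) :
    ∫ y, ∏ l, h l (y l) ∂(μT n) = ∏ l, ∫ t in (0 : ℝ)..1, h l t := by
  have h1 : μT n = Measure.pi fun _ : Fin n => (volume : Measure ℝ).restrict (Set.Ico 0 1) := by
    rw [← Measure.restrict_pi_pi]; rfl
  rw [h1, integral_fintype_prod_eq_prod]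
  refine Finset.prod_congr rfl fun l _ => ?_
  rw [intervalIntegral.integral_of_le zero_le_one, integral_Ico_eq_integral_Ioc]

lemma inv_one_add_sum_pow_le (hn : 1 ≤ n) {k : ℕ} {A : Fin n → ℝ} (hA : ∀ l, 0 ≤ A l) :
    (1 + ∑ l, A l ^ (2 * k))⁻¹ ≤ ∏ l, ((1 + A l) / 2) ^ (-(2 * k / n : ℝ)) := by
  have hn' : (0 : ℝ) < n := by exact_mod_cast hn
  set W : ℝ := 1 + ∑ l, A l ^ (2 * k) with hW
  have hWpos : 0 < W := add_pos_of_pos_of_nonneg one_pos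
    (Finset.sum_nonneg fun l _ => pow_nonneg (hA l) _)
  have hone : ∀ l, ((1 + A l) / 2) ^ (2 * k) ≤ W := by
    intro l
    have hl := Finset.single_le_sum (f := fun l => A l ^ (2 * k))
      (fun l _ => pow_nonneg (hA l) _) (Finset.mem_univ l)
    have hs : 0 ≤ ∑ l, A l ^ (2 * k) := Finset.sum_nonneg fun l _ => pow_nonneg (hA l) _
    rcases le_total (A l) 1 with h | h
    · have : ((1 + A l) / 2) ^ (2 * k) ≤ 1 :=
        pow_le_one₀ (by linarith [hA l]) (by linarith)
      linarith
    · have : ((1 + A l) / 2) ^ (2 * k) ≤ A l ^ (2 * k) :=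
        pow_le_pow_left₀ (by linarith [hA l]) (by linarith) _
      linarith
  have hl : ∀ l, W ^ (-(1 / n : ℝ)) ≤ ((1 + A l) / 2) ^ (-(2 * k / n : ℝ)) := by
    intro l
    have hp : 0 < (1 + A l) / 2 := by linarith [hA l]
    have h1 := Real.rpow_le_rpow_of_nonpos (z := -(1 / n : ℝ)) (by positivity) (hone l)
      (neg_nonpos.2 (by positivity))
    refine h1.trans (le_of_eq ?_)
    rw [← Real.rpow_natCast, ← Real.rpow_mul hp.le]
    congr 1
    push_cast
    ring
  calc W⁻¹ = ∏ _l : Fin n, W ^ (-(1 / n : ℝ)) := by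
        rw [Finset.prod_const, Finset.card_univ, Fintype.card_fin, ← Real.rpow_natCast,
          ← Real.rpow_mul hWpos.le, ← Real.rpow_neg_one]
        congr 1
        field_simp
    _ ≤ _ := Finset.prod_le_prod (fun l _ => by positivity) fun l _ => hl l

lemma exists_integral_inv_weight_le (hn : 1 ≤ n) {k : ℕ} (hk : n < 2 * k) :
    ∃ C : ℝ, 0 ≤ C ∧ ∀ b : ℝ, 0 < b → ∀ x : Fin n → ℝ,
      ∫ y, (1 + ∑ l, (b * |2 * sin (π * (x l - y l))|) ^ (2 * k))⁻¹ ∂(μT n) ≤ C / b ^ n := by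
  have hn' : (0 : ℝ) < n := by exact_mod_cast hn
  obtain ⟨C, hC, h⟩ := exists_integral_sin_weight_le (s := 2 * k / n) (by
    rw [one_lt_div hn']; exact_mod_cast hk)
  refine ⟨C ^ n, by positivity, fun b hb x => ?_⟩
  have hpos : ∀ y : Fin n → ℝ, 0 < 1 + ∑ l, (b * |2 * sin (π * (x l - y l))|) ^ (2 * k) :=
    fun y => add_pos_of_pos_of_nonneg one_pos (Finset.sum_nonneg fun l _ => by positivity)
  calc ∫ y, (1 + ∑ l, (b * |2 * sin (π * (x l - y l))|) ^ (2 * k))⁻¹ ∂(μT n)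
      ≤ ∫ y, ∏ l, ((1 + b * |2 * sin (π * (x l - y l))|) / 2) ^ (-(2 * k / n : ℝ)) ∂(μT n) := by
        refine integral_mono (integrable_of_continuous ?_) (integrable_of_continuous ?_) fun y => ?_
        · exact Continuous.inv₀ (by fun_prop) fun y => (hpos y).ne'
        · refine continuous_finsetProd _ fun l _ => Continuous.rpow_const (by fun_prop) fun y => ?_
          left; positivity
        · exact inv_one_add_sum_pow_le hn fun l => by positivity
    _ = ∏ l, ∫ t in (0 : ℝ)..1, ((1 + b * |2 * sin (π * (x l - t))|) / 2) ^ (-(2 * k / n : ℝ)) :=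
        integral_prod_μT fun l t => ((1 + b * |2 * sin (π * (x l - t))|) / 2) ^ (-(2 * k / n : ℝ))
    _ ≤ ∏ _l : Fin n, C / b := by
        refine Finset.prod_le_prod (fun l _ => ?_) fun l _ => h b hb (x l)
        exact intervalIntegral.integral_nonneg zero_le_one fun t _ => by positivity
    _ = C ^ n / b ^ n := by
        rw [Finset.prod_const, Finset.card_univ, Fintype.card_fin, div_pow]

lemma support_dd_finite {σ : (Fin n → ℤ) → ℂ} (hσ : σ.support.Finite) (l : Fin n) :
    (dd l σ).support.Finite := by
  have h1 : (fun ξ => σ (ξ + Pi.single l 1)).support.Finite :=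
    hσ.preimage (add_left_injective (Pi.single l 1 : Fin n → ℤ)).injOn
  exact (h1.union hσ).subset (Function.support_sub _ _)

lemma tsum_dd_mul_eChar {σ : (Fin n → ℤ) → ℂ} (hσ : σ.support.Finite) (l : Fin n)
    (z : Fin n → ℝ) : ∑' ξ, dd l σ ξ * eChar z ξ
      = (eChar z (-Pi.single l 1) - 1) * ∑' ξ, σ ξ * eChar z ξ := by
  have hsum : ∀ {τ : (Fin n → ℤ) → ℂ}, τ.support.Finite → Summable fun ξ => τ ξ * eChar z ξ :=
    fun hτ => summable_of_hasFiniteSupport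
      (hτ.subset (Function.support_mul_subset_left _ _))
  have h1 : (fun ξ => σ (ξ + Pi.single l 1)).support.Finite :=
    hσ.preimage (add_left_injective (Pi.single l 1 : Fin n → ℤ)).injOn
  simp only [dd, sub_mul]
  rw [(hsum h1).tsum_sub (hsum hσ), one_mul, ← tsum_mul_left,
    ← (Equiv.addRight (Pi.single l 1 : Fin n → ℤ)).tsum_eq
      fun ξ => eChar z (-Pi.single l 1) * (σ ξ * eChar z ξ)]
  congr 1
  refine tsum_congr fun ξ => ?_
  rw [Equiv.coe_addRight, eChar_add_right, mul_left_comm, mul_left_comm (eChar z _) (eChar z _),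
    eChar_neg_mul_self, mul_one]

lemma tsum_iterate_dd_mul_eChar {σ : (Fin n → ℤ) → ℂ} (hσ : σ.support.Finite) (l : Fin n)
    (z : Fin n → ℝ) (k : ℕ) : ((dd l)^[k] σ).support.Finite ∧
      ∑' ξ, (dd l)^[k] σ ξ * eChar z ξ
        = (eChar z (-Pi.single l 1) - 1) ^ k * ∑' ξ, σ ξ * eChar z ξ := by
  induction k with
  | zero => exact ⟨hσ, by simp⟩
  | succ k ih =>
    simp only [Function.iterate_succ_apply']
    exact ⟨support_dd_finite ih.1 l, by rw [tsum_dd_mul_eChar ih.1, ih.2, pow_succ']; ring⟩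

lemma norm_eChar_neg_single_sub_one (z : Fin n → ℝ) (l : Fin n) :
    ‖eChar z (-Pi.single l 1) - 1‖ = |2 * sin (π * z l)| := by
  have h : eChar z (-Pi.single l 1) = Complex.exp (Complex.I * ((-(2 * (π * z l)) : ℝ) : ℂ)) := by
    simp only [eChar, Pi.neg_apply, Int.cast_neg, mul_neg, Finset.sum_neg_distrib, Pi.single_apply]
    congr 1
    simp
    ring
  rw [h, Complex.norm_exp_I_mul_ofReal_sub_one, neg_div, mul_div_cancel_left₀ _ two_ne_zero,
    sin_neg, mul_neg, norm_neg, Real.norm_eq_abs]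

lemma integral_norm_sq_kernel (F : Finset (Fin n → ℤ)) (σ : (Fin n → ℤ) → ℂ) (x : Fin n → ℝ) :
    ∫ y, ‖∑ ξ ∈ F, σ ξ * eChar (x - y) ξ‖ ^ 2 ∂(μT n) = ∑ ξ ∈ F, ‖σ ξ‖ ^ 2 := by
  have h : ∀ y : Fin n → ℝ, ‖∑ ξ ∈ F, σ ξ * eChar (x - y) ξ‖
      = ‖∑ ξ ∈ F, (starRingEnd ℂ) (σ ξ * eChar x ξ) * eChar y ξ‖ := by
    intro y
    rw [← Complex.norm_conj, map_sum]
    congr 1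
    refine Finset.sum_congr rfl fun ξ _ => ?_
    rw [eChar_sub_left, ← mul_assoc, map_mul _ _ (eChar y (-ξ)), star_eChar, neg_neg]
  simp only [h]
  rw [integral_norm_sq_trigPoly]
  exact Finset.sum_congr rfl fun ξ _ => by rw [Complex.norm_conj, norm_mul, norm_eChar, mul_one]

/-- Uniform bound for an operator whose symbol is localized to a set `F` of frequencies and is
smooth at scale `b` in the frequency variable. -/
lemma exists_norm_finOp_le (hn : 1 ≤ n) {k : ℕ} (hk : n < 2 * k) :
    ∃ C : ℝ, 0 ≤ C ∧ ∀ (F : Finset (Fin n → ℤ)) (s : (Fin n → ℝ) → (Fin n → ℤ) → ℂ)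
      (x : Fin n → ℝ) (b A M : ℝ), 0 < b → 0 ≤ M → (s x).support ⊆ F →
      (∀ l, ((dd l)^[k] (s x)).support ⊆ F) → (∀ ξ, ‖s x ξ‖ ≤ A) →
      (∀ l ξ, b ^ k * ‖(dd l)^[k] (s x) ξ‖ ≤ A) → F.card * A ^ 2 ≤ M ^ 2 * b ^ n →
      ∀ (f : (Fin n → ℝ) → ℂ) (B : ℝ), Measurable f → (∀ x, ‖f x‖ ≤ B) →
        ‖finOp F s f x‖ ≤ C * M * B := by
  obtain ⟨C, hC, hCw⟩ := exists_integral_inv_weight_le hn hk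
  refine ⟨√((1 + n) * C), by positivity, ?_⟩
  intro F s x b A M hb hM hs hds hA hdA hcard f B hf hB
  have hB0 : 0 ≤ B := (norm_nonneg _).trans (hB x)
  have hfin : (s x).support.Finite := F.finite_toSet.subset hs
  set K : (Fin n → ℝ) → ℂ := fun y => ∑ ξ ∈ F, s x ξ * eChar (x - y) ξ with hK
  have hcontK : ∀ σ : (Fin n → ℤ) → ℂ,
      Continuous fun y : Fin n → ℝ => ∑ ξ ∈ F, σ ξ * eChar (x - y) ξ := fun σ =>
    (trigPoly_continuous F σ).comp (continuous_const.sub continuous_id)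
  have hKd : ∀ l y, ‖∑ ξ ∈ F, (dd l)^[k] (s x) ξ * eChar (x - y) ξ‖
      = |2 * sin (π * (x l - y l))| ^ k * ‖K y‖ := by
    intro l y
    have h := (tsum_iterate_dd_mul_eChar hfin l (x - y) k).2
    rw [tsum_eq_sum (s := F), tsum_eq_sum (s := F)] at h
    · rw [h, norm_mul, norm_pow, norm_eChar_neg_single_sub_one]; rfl
    · intro ξ hξ
      rw [Function.notMem_support.1 fun h' => hξ (hs h'), zero_mul]
    · intro ξ hξ
      rw [Function.notMem_support.1 fun h' => hξ (hds l h'), zero_mul]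
  have hsq : ∀ σ : (Fin n → ℤ) → ℂ, (∀ ξ, ‖σ ξ‖ ≤ A) →
      ∫ y, ‖∑ ξ ∈ F, σ ξ * eChar (x - y) ξ‖ ^ 2 ∂(μT n) ≤ M ^ 2 * b ^ n := by
    intro σ hσ
    rw [integral_norm_sq_kernel]
    calc ∑ ξ ∈ F, ‖σ ξ‖ ^ 2 ≤ ∑ _ξ ∈ F, A ^ 2 :=
          Finset.sum_le_sum fun ξ _ => pow_le_pow_left₀ (norm_nonneg _) (hσ ξ) 2
      _ ≤ _ := by rw [Finset.sum_const, nsmul_eq_mul]; exact hcard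
  set W : (Fin n → ℝ) → ℝ := fun y => 1 + ∑ l, (b * |2 * sin (π * (x l - y l))|) ^ (2 * k)
    with hWdef
  have hWpos : ∀ y, 0 < W y := fun y =>
    add_pos_of_pos_of_nonneg one_pos (Finset.sum_nonneg fun l _ => by positivity)
  have hWc : Continuous W := by fun_prop
  have hKc : Continuous K := hcontK _
  have hWK : ∫ y, W y * ‖K y‖ ^ 2 ∂(μT n) ≤ (1 + n) * (M ^ 2 * b ^ n) := by
    have h1 : ∀ y, W y * ‖K y‖ ^ 2 = ‖K y‖ ^ 2
        + ∑ l, ‖∑ ξ ∈ F, (b ^ k * (dd l)^[k] (s x) ξ : ℂ) * eChar (x - y) ξ‖ ^ 2 := by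
      intro y
      have h2 : ∀ l, ‖∑ ξ ∈ F, (b ^ k * (dd l)^[k] (s x) ξ : ℂ) * eChar (x - y) ξ‖ ^ 2
          = (b * |2 * sin (π * (x l - y l))|) ^ (2 * k) * ‖K y‖ ^ 2 := by
        intro l
        simp only [mul_assoc]
        rw [← Finset.mul_sum, norm_mul, hKd, norm_pow, Complex.norm_real,
          Real.norm_of_nonneg hb.le]
        ring
      simp only [h2, hWdef, add_mul, one_mul, Finset.sum_mul]
    simp only [h1]
    have hi : ∀ σ : (Fin n → ℤ) → ℂ,
        Integrable (fun y => ‖∑ ξ ∈ F, σ ξ * eChar (x - y) ξ‖ ^ 2) (μT n) := fun σ =>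
      integrable_of_continuous ((hcontK σ).norm.pow 2)
    rw [integral_add (hi _) (integrable_finsetSum _ fun l _ => hi _),
      integral_finsetSum _ fun l _ => hi _, add_mul, one_mul]
    refine add_le_add (hsq _ hA) ?_
    calc _ ≤ ∑ _l : Fin n, M ^ 2 * b ^ n := Finset.sum_le_sum fun l _ => hsq _ fun ξ => by
          rw [norm_mul, norm_pow, Complex.norm_real, Real.norm_of_nonneg hb.le]
          exact hdA l ξ
      _ = _ := by rw [Finset.sum_const, Finset.card_univ, Fintype.card_fin, nsmul_eq_mul]
  have hKL1 : ∫ y, ‖K y‖ ∂(μT n) ≤ √((1 + n) * C) * M := by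
    have hm : ∀ g : (Fin n → ℝ) → ℝ, Continuous g → MemLp g (ENNReal.ofReal 2) (μT n) := by
      intro g hg
      rw [ENNReal.ofReal_ofNat]
      exact (memLp_two_iff_integrable_sq hg.aestronglyMeasurable).2
        (integrable_of_continuous (hg.pow 2))
    have hc1 : Continuous fun y => √(W y) * ‖K y‖ := (hWc.sqrt).mul hKc.norm
    have hc2 : Continuous fun y => √(W y)⁻¹ := (hWc.inv₀ fun y => (hWpos y).ne').sqrt
    have h := integral_mul_le_Lp_mul_Lq_of_nonneg (μ := μT n) Real.HolderConjugate.two_two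
      (.of_forall fun y => by positivity) (.of_forall fun y => by positivity) (hm _ hc1) (hm _ hc2)
    have h2 : ∀ y, √(W y) * ‖K y‖ * √(W y)⁻¹ = ‖K y‖ := by
      intro y
      rw [mul_right_comm, ← Real.sqrt_mul (hWpos y).le, mul_inv_cancel₀ (hWpos y).ne',
        Real.sqrt_one, one_mul]
    have h3 : ∀ y, (√(W y) * ‖K y‖) ^ (2 : ℝ) = W y * ‖K y‖ ^ 2 := fun y => by
      rw [Real.rpow_two, mul_pow, Real.sq_sqrt (hWpos y).le]
    have h4 : ∀ y, √(W y)⁻¹ ^ (2 : ℝ) = (W y)⁻¹ := fun y => by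
      rw [Real.rpow_two, Real.sq_sqrt (inv_nonneg.2 (hWpos y).le)]
    simp only [h2, h3, h4, ← Real.sqrt_eq_rpow] at h
    refine h.trans ?_
    rw [← Real.sqrt_mul (integral_nonneg fun y => mul_nonneg (hWpos y).le (by positivity))]
    calc _ ≤ √(((1 + n) * C) * M ^ 2) := by
          apply Real.sqrt_le_sqrt
          calc _ ≤ (1 + n) * (M ^ 2 * b ^ n) * (C / b ^ n) := by
                refine mul_le_mul hWK (hCw b hb x) ?_ (by positivity)
                exact integral_nonneg fun y => inv_nonneg.2 (hWpos y).le
            _ = _ := by field_simp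
      _ = _ := by rw [Real.sqrt_mul (by positivity), Real.sqrt_sq hM]
  have hrep : finOp F s f x = ∫ y, K y * f y ∂(μT n) := by
    have hi : ∀ ξ ∈ F, Integrable (fun y => eChar x ξ * s x ξ * (eChar y (-ξ) * f y)) (μT n) := by
      intro ξ _
      refine Integrable.const_mul (integrable_of_bounded (B := B)
        ((eChar_continuous_left _).measurable.mul hf) fun y => ?_) _
      simpa [norm_eChar] using hB y
    simp only [finOp, fc_eq, ← integral_const_mul]
    rw [← integral_finsetSum _ hi]
    refine integral_congr_ae (.of_forall fun y => ?_)
    simp only [hK, Finset.sum_mul]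
    refine Finset.sum_congr rfl fun ξ _ => ?_
    rw [eChar_sub_left]
    ring
  rw [hrep]
  calc ‖∫ y, K y * f y ∂(μT n)‖ ≤ ∫ y, ‖K y‖ * B ∂(μT n) := by
        refine norm_integral_le_of_norm_le ((integrable_of_continuous hKc.norm).mul_const B)
          (.of_forall fun y => ?_)
        rw [norm_mul]
        exact mul_le_mul_of_nonneg_left (hB y) (norm_nonneg _)
    _ = (∫ y, ‖K y‖ ∂(μT n)) * B := integral_mul_const _ _
    _ ≤ _ := mul_le_mul_of_nonneg_right hKL1 hB0

end Kernel

section Interpolation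

variable {α : Type*} [MeasurableSpace α] {μ : Measure α}

lemma measure_norm_lt_le {T : (α → ℂ) → α → ℂ} {N : ℝ≥0∞} {M : ℝ} (hM : 0 < M)
    (hadd : ∀ f g x, Measurable f → Measurable g → (∃ B, ∀ x, ‖f x‖ ≤ B) → (∃ B, ∀ x, ‖g x‖ ≤ B) →
      T (f + g) x = T f x + T g x)
    (hmeas : ∀ f, Measurable (T f))
    (htwo : ∀ f B, Measurable f → (∀ x, ‖f x‖ ≤ B) →
      ∫⁻ x, ‖T f x‖ₑ ^ 2 ∂μ ≤ N * ∫⁻ x, ‖f x‖ₑ ^ 2 ∂μ)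
    (hinfty : ∀ f B, Measurable f → (∀ x, ‖f x‖ ≤ B) → ∀ x, ‖T f x‖ ≤ M * B)
    {f : α → ℂ} (hf : Measurable f) {B : ℝ} (hB : ∀ x, ‖f x‖ ≤ B) {t : ℝ} (ht : 0 < t) :
    μ {x | t < ‖T f x‖} ≤ 4 * N * (μ.withDensity fun x => ‖f x‖ₑ ^ 2) {x | t < 2 * M * ‖f x‖}
      * ENNReal.ofReal (t ^ (-2 : ℝ)) := by
  set S : Set α := {x | t < 2 * M * ‖f x‖} with hS
  have hSm : MeasurableSet S := measurableSet_lt measurable_const (hf.norm.const_mul _)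
  set g : α → ℂ := S.indicator f with hg
  set h : α → ℂ := Sᶜ.indicator f with hh
  have hgm : Measurable g := hf.indicator hSm
  have hhm : Measurable h := hf.indicator hSm.compl
  have hgh : g + h = f := Set.indicator_self_add_compl S f
  have hgB : ∀ x, ‖g x‖ ≤ B := fun x => (norm_indicator_le_norm_self f x).trans (hB x)
  have hhB : ∀ x, ‖h x‖ ≤ t / (2 * M) := by
    intro x
    rw [hh, Set.indicator_apply]
    split_ifs with hx
    · rw [le_div_iff₀ (by positivity)]
      have : ¬ t < 2 * M * ‖f x‖ := hx
      linarith
    · rw [norm_zero]; positivity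
  have hsub : {x | t < ‖T f x‖} ⊆ {x | ENNReal.ofReal ((t / 2) ^ 2) ≤ ‖T g x‖ₑ ^ 2} := by
    intro x hx
    have h1 : ‖T f x‖ ≤ ‖T g x‖ + ‖T h x‖ := by
      rw [← hgh, hadd g h x hgm hhm ⟨B, hgB⟩ ⟨_, hhB⟩]
      exact norm_add_le _ _
    have h2 : ‖T h x‖ ≤ t / 2 := by
      refine (hinfty h _ hhm hhB x).trans (le_of_eq ?_)
      field_simp
    have h3 : t / 2 ≤ ‖T g x‖ := by
      have : t < ‖T f x‖ := hx
      linarith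
    rw [Set.mem_ofPred_eq, ← ofReal_norm, ← ENNReal.ofReal_pow (norm_nonneg _)]
    exact ENNReal.ofReal_le_ofReal (pow_le_pow_left₀ (by positivity) h3 2)
  have hgν : ∫⁻ x, ‖g x‖ₑ ^ 2 ∂μ = (μ.withDensity fun x => ‖f x‖ₑ ^ 2) S := by
    rw [withDensity_apply _ hSm, ← lintegral_indicator hSm]
    refine lintegral_congr fun x => ?_
    rw [hg, Set.indicator_apply, Set.indicator_apply]
    split_ifs <;> simp
  have hcheb := mul_meas_ge_le_lintegral (μ := μ) ((hmeas g).enorm.pow_const 2)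
    (ENNReal.ofReal ((t / 2) ^ 2))
  have hpos : ENNReal.ofReal ((t / 2) ^ 2) ≠ 0 := by
    rw [Ne, ENNReal.ofReal_eq_zero, not_le]; positivity
  have hinv : (ENNReal.ofReal ((t / 2) ^ 2))⁻¹ = 4 * ENNReal.ofReal (t ^ (-2 : ℝ)) := by
    rw [← ENNReal.ofReal_inv_of_pos (by positivity), ← ENNReal.ofReal_ofNat,
      ← ENNReal.ofReal_mul (by norm_num)]
    congr 1
    rw [Real.rpow_neg ht.le, Real.rpow_two]
    field_simp
    norm_num
  calc μ {x | t < ‖T f x‖} ≤ μ {x | ENNReal.ofReal ((t / 2) ^ 2) ≤ ‖T g x‖ₑ ^ 2} :=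
        measure_mono hsub
    _ ≤ (∫⁻ x, ‖T g x‖ₑ ^ 2 ∂μ) * (ENNReal.ofReal ((t / 2) ^ 2))⁻¹ := by
        rw [← div_eq_mul_inv, ENNReal.le_div_iff_mul_le (.inl hpos) (.inl ENNReal.ofReal_ne_top),
          mul_comm]
        exact hcheb
    _ ≤ N * (μ.withDensity fun x => ‖f x‖ₑ ^ 2) S * (4 * ENNReal.ofReal (t ^ (-2 : ℝ))) := by
        rw [hinv, ← hgν]
        gcongr
        exact htwo g B hgm hgB
    _ = _ := by ring

lemma lintegral_enorm_rpow_eq {p : ℝ} (hp : 0 ≤ p) (f : α → ℂ) :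
    ∫⁻ x, ‖f x‖ₑ ^ p ∂μ = ∫⁻ x, ENNReal.ofReal (‖f x‖ ^ p) ∂μ :=
  lintegral_congr fun x => by
    rw [← ENNReal.ofReal_rpow_of_nonneg (norm_nonneg _) hp, ofReal_norm]

/-- Marcinkiewicz interpolation between `L²` and `L^∞`, tracking the dependence on both norms. -/
lemma exists_lintegral_rpow_le {p : ℝ} (hp : 2 ≤ p) :
    ∃ C : ℝ≥0∞, C ≠ ⊤ ∧ ∀ (T : (α → ℂ) → α → ℂ) (N : ℝ≥0∞) (M : ℝ), 0 < M →
      (∀ f g x, Measurable f → Measurable g → (∃ B, ∀ x, ‖f x‖ ≤ B) → (∃ B, ∀ x, ‖g x‖ ≤ B) →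
        T (f + g) x = T f x + T g x) →
      (∀ f, Measurable (T f)) →
      (∀ f B, Measurable f → (∀ x, ‖f x‖ ≤ B) →
        ∫⁻ x, ‖T f x‖ₑ ^ 2 ∂μ ≤ N * ∫⁻ x, ‖f x‖ₑ ^ 2 ∂μ) →
      (∀ f B, Measurable f → (∀ x, ‖f x‖ ≤ B) → ∀ x, ‖T f x‖ ≤ M * B) →
      ∀ f B, Measurable f → (∀ x, ‖f x‖ ≤ B) →
        ∫⁻ x, ‖T f x‖ₑ ^ p ∂μ
          ≤ C * N * ENNReal.ofReal (M ^ (p - 2)) * ∫⁻ x, ‖f x‖ₑ ^ p ∂μ := by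
  rcases hp.eq_or_lt with rfl | hp'
  · refine ⟨1, ENNReal.one_ne_top, ?_⟩
    intro T N M hM hadd hmeas htwo hinfty f B hf hB
    simpa using htwo f B hf hB
  refine ⟨4 * ENNReal.ofReal p * ENNReal.ofReal (2 ^ (p - 2)) / ENNReal.ofReal (p - 2), ?_, ?_⟩
  · exact ENNReal.div_ne_top (by finiteness)
      (by rw [Ne, ENNReal.ofReal_eq_zero, not_le]; linarith)
  intro T N M hM hadd hmeas htwo hinfty f B hf hB
  set ν : Measure α := μ.withDensity fun x => ‖f x‖ₑ ^ 2 with hν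
  have hp0 : ENNReal.ofReal (p - 2) ≠ 0 := by
    rw [Ne, ENNReal.ofReal_eq_zero, not_le]; linarith
  have hlay := lintegral_rpow_eq_lintegral_meas_lt_mul ν (f := fun x => 2 * M * ‖f x‖)
    (.of_forall fun x => by positivity) (hf.norm.const_mul _).aemeasurable (p := p - 2)
    (by linarith)
  have hν_int : ∫⁻ x, ENNReal.ofReal ((2 * M * ‖f x‖) ^ (p - 2)) ∂ν
      = ENNReal.ofReal (2 ^ (p - 2)) * ENNReal.ofReal (M ^ (p - 2)) * ∫⁻ x, ‖f x‖ₑ ^ p ∂μ := by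
    rw [hν, lintegral_withDensity_eq_lintegral_mul _ (hf.enorm.pow_const 2)
      ((((hf.norm.const_mul _).pow_const _)).ennreal_ofReal),
      ← lintegral_const_mul' _ _ (by finiteness)]
    refine lintegral_congr fun x => ?_
    rw [Pi.mul_apply, Real.mul_rpow (by positivity) (norm_nonneg _),
      Real.mul_rpow zero_le_two hM.le, ENNReal.ofReal_mul (by positivity),
      ENNReal.ofReal_mul (by positivity),
      ← ENNReal.ofReal_rpow_of_nonneg (norm_nonneg _) (by linarith), ofReal_norm,
      mul_left_comm]
    congr 1
    rw [← ENNReal.rpow_two, ← ENNReal.rpow_add_of_nonneg _ _ (by norm_num) (by linarith)]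
    congr 1
    ring
  calc ∫⁻ x, ‖T f x‖ₑ ^ p ∂μ
      = ENNReal.ofReal p * ∫⁻ t in Set.Ioi 0, μ {x | t < ‖T f x‖} * ENNReal.ofReal (t ^ (p - 1)) := by
        rw [lintegral_enorm_rpow_eq (by linarith)]
        exact lintegral_rpow_eq_lintegral_meas_lt_mul μ (.of_forall fun x => norm_nonneg _)
          (hmeas f).norm.aemeasurable (by linarith)
    _ ≤ ENNReal.ofReal p * ∫⁻ t in Set.Ioi 0,
          4 * N * (ν {x | t < 2 * M * ‖f x‖} * ENNReal.ofReal (t ^ (p - 2 - 1))) := by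
        refine mul_le_mul_right (setLIntegral_mono' measurableSet_Ioi fun t (ht : 0 < t) => ?_) _
        refine (mul_le_mul_left
          (measure_norm_lt_le hM hadd hmeas htwo hinfty hf hB ht) _).trans (le_of_eq ?_)
        rw [mul_assoc, ← ENNReal.ofReal_mul (by positivity), ← Real.rpow_add ht, mul_assoc _ (ν _)]
        congr 4
        ring
    _ = 4 * ENNReal.ofReal p * N * (∫⁻ t in Set.Ioi 0,
          ν {x | t < 2 * M * ‖f x‖} * ENNReal.ofReal (t ^ (p - 2 - 1))) := by
        rw [lintegral_const_mul'']
        · ring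
        · have hanti : Antitone fun t : ℝ => ν {x | t < 2 * M * ‖f x‖} := fun t u htu =>
            measure_mono fun x hx => lt_of_le_of_lt htu hx
          exact (hanti.measurable.mul (by fun_prop)).aemeasurable
    _ = 4 * ENNReal.ofReal p * N * ((∫⁻ x, ENNReal.ofReal ((2 * M * ‖f x‖) ^ (p - 2)) ∂ν)
          / ENNReal.ofReal (p - 2)) := by
        rw [hlay, mul_div_assoc, ENNReal.mul_div_cancel hp0 ENNReal.ofReal_ne_top]
    _ = _ := by
        rw [hν_int]
        simp only [div_eq_mul_inv]
        ring

end Interpolation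

section Cutoffs

variable {n : ℕ}

lemma norm_iterate_fwdDiff_le {h : ℝ} (hh : 0 ≤ h) {B : ℝ} (i : ℕ) {g : ℝ → ℂ}
    (hg : ContDiff ℝ (⊤ : ℕ∞) g) (hB : ∀ t, ‖iteratedDeriv i g t‖ ≤ B) (t : ℝ) :
    ‖(fwdDiff h)^[i] g t‖ ≤ B * h ^ i := by
  induction i generalizing g B with
  | zero => simpa using hB t
  | succ i ih =>
    rw [Function.iterate_succ_apply]
    have hg' : ContDiff ℝ (⊤ : ℕ∞) fun t => g (t + h) := hg.comp (contDiff_id.add contDiff_const)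
    have hle : ((i : ℕ) : WithTop ℕ∞) ≤ ((⊤ : ℕ∞) : WithTop ℕ∞) := by exact_mod_cast le_top
    have hlt : ((i : ℕ) : WithTop ℕ∞) < ((⊤ : ℕ∞) : WithTop ℕ∞) := by
      exact_mod_cast ENat.natCast_lt_top i
    refine (ih (B := B * h) (g := fwdDiff h g) (hg'.sub hg) fun t => ?_).trans (le_of_eq (by ring))
    have h1 : iteratedDeriv i (fwdDiff h g) t
        = iteratedDeriv i g (t + h) - iteratedDeriv i g t := by
      have h2 := iteratedDeriv_fun_sub (x := t) ((hg'.of_le hle).contDiffAt)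
        ((hg.of_le hle).contDiffAt)
      rw [iteratedDeriv_comp_add_const] at h2
      exact h2
    rw [h1]
    have := convex_univ.norm_image_sub_le_of_norm_deriv_le (f := iteratedDeriv i g)
      (fun x _ => hg.differentiable_iteratedDeriv i hlt x)
      (fun x _ => by rw [← iteratedDeriv_succ]; exact hB x) (Set.mem_univ t) (Set.mem_univ (t + h))
    rwa [add_sub_cancel_left, Real.norm_of_nonneg hh] at this

lemma iterate_dd_mul_comp {l : Fin n} {c : (Fin n → ℤ) → ℂ}
    (hc : ∀ ξ, c (ξ + Pi.single l 1) = c ξ) (h : ℝ) (i : ℕ) (g : ℝ → ℂ) :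
    (dd l)^[i] (fun ξ => c ξ * g (ξ l * h)) = fun ξ => c ξ * (fwdDiff h)^[i] g (ξ l * h) := by
  induction i generalizing g with
  | zero => rfl
  | succ i ih =>
    rw [Function.iterate_succ_apply, Function.iterate_succ_apply, ← ih]
    congr 1
    funext ξ
    simp only [dd, hc, fwdDiff, Pi.add_apply, Pi.single_eq_same, Int.cast_add, Int.cast_one,
      add_mul, one_mul, mul_sub]

lemma iterate_dd_add (l : Fin n) (i : ℕ) (f g : (Fin n → ℤ) → ℂ) :
    (dd l)^[i] (f + g) = (dd l)^[i] f + (dd l)^[i] g := by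
  induction i generalizing f g with
  | zero => rfl
  | succ i ih =>
    simp only [Function.iterate_succ_apply]
    rw [← ih]
    congr 1
    funext ξ
    simp only [dd, Pi.add_apply]
    ring

lemma iterate_dd_sub (l : Fin n) (i : ℕ) (f g : (Fin n → ℤ) → ℂ) :
    (dd l)^[i] (f - g) = (dd l)^[i] f - (dd l)^[i] g := by
  rw [eq_sub_iff_add_eq, ← iterate_dd_add, sub_add_cancel]

lemma iterate_dd_shift (l : Fin n) (i : ℕ) (f : (Fin n → ℤ) → ℂ) (v ξ : Fin n → ℤ) :
    (dd l)^[i] (fun ξ => f (ξ + v)) ξ = (dd l)^[i] f (ξ + v) := by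
  induction i generalizing f with
  | zero => rfl
  | succ i ih =>
    rw [Function.iterate_succ_apply, Function.iterate_succ_apply, ← ih]
    refine congrArg (fun u => (dd l)^[i] u ξ) (funext fun ζ => ?_)
    simp only [dd, add_right_comm]

lemma iterate_dd_eq_zero {l : Fin n} {k : ℕ} {f : (Fin n → ℤ) → ℂ} {ξ : Fin n → ℤ}
    (h : ∀ t ≤ k, f (ξ + t • Pi.single l 1) = 0) : (dd l)^[k] f ξ = 0 := by
  induction k generalizing f with
  | zero => simpa using h 0 le_rfl
  | succ k ih =>
    rw [Function.iterate_succ_apply]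
    refine ih fun t ht => ?_
    have h1 := h (t + 1) (by omega)
    rw [succ_nsmul, ← add_assoc] at h1
    rw [dd, h1, h t (by omega), sub_zero]

/-- A Leibniz-type estimate for iterated differences of a product. -/
lemma norm_iterate_dd_mul_le {l : Fin n} {k : ℕ} {A B r : ℝ} {f g : (Fin n → ℤ) → ℂ}
    {ξ : Fin n → ℤ}
    (hf : ∀ i t, i + t ≤ k → ‖(dd l)^[i] f (ξ + t • Pi.single l 1)‖ ≤ A * r ^ i)
    (hg : ∀ i t, i + t ≤ k → ‖(dd l)^[i] g (ξ + t • Pi.single l 1)‖ ≤ B * r ^ i) :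
    ‖(dd l)^[k] (fun ξ => f ξ * g ξ) ξ‖ ≤ 2 ^ k * (A * B) * r ^ k := by
  induction k generalizing f g A B with
  | zero =>
    have h1 := hf 0 0 le_rfl
    have h2 := hg 0 0 le_rfl
    simp only [Function.iterate_zero, id_eq, zero_smul, add_zero, pow_zero, mul_one, one_mul,
      norm_mul] at h1 h2 ⊢
    exact mul_le_mul h1 h2 (norm_nonneg _) ((norm_nonneg _).trans h1)
  | succ k ih =>
    have hfg : dd l (fun ξ => f ξ * g ξ)
        = (fun ξ => dd l f ξ * g (ξ + Pi.single l 1)) + fun ξ => f ξ * dd l g ξ := by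
      funext ξ
      simp only [dd, Pi.add_apply]
      ring
    rw [Function.iterate_succ_apply, hfg, iterate_dd_add]
    refine (norm_add_le _ _).trans ?_
    have hfst := ih (A := A * r) (B := B) (f := dd l f) (g := fun ξ => g (ξ + Pi.single l 1))
      (fun i t hit => by
        have := hf (i + 1) t (by omega)
        rw [Function.iterate_succ_apply] at this
        exact this.trans (le_of_eq (by ring)))
      (fun i t hit => by
        have := hg i (t + 1) (by omega)
        rwa [succ_nsmul, ← add_assoc, ← iterate_dd_shift] at this)
    have hsnd := ih (A := A) (B := B * r) (f := f) (g := dd l g)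
      (fun i t hit => hf i t (by omega))
      (fun i t hit => by
        have := hg (i + 1) t (by omega)
        rw [Function.iterate_succ_apply] at this
        exact this.trans (le_of_eq (by ring)))
    refine (add_le_add hfst hsnd).trans (le_of_eq ?_)
    ring

lemma one_le_jb (ξ : Fin n → ℤ) : 1 ≤ jb ξ := by
  rw [jb, Real.one_le_sqrt]
  exact le_add_of_nonneg_right (Finset.sum_nonneg fun j _ => sq_nonneg _)

lemma abs_le_jb (ξ : Fin n → ℤ) (m : Fin n) : |(ξ m : ℝ)| ≤ jb ξ := by
  apply Real.abs_le_sqrt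
  have := Finset.single_le_sum (f := fun j => (ξ j : ℝ) ^ 2) (fun _ _ => sq_nonneg _)
    (Finset.mem_univ m)
  linarith

lemma jb_add_zsmul_le (ξ : Fin n → ℤ) (l : Fin n) (m : ℤ) :
    jb (ξ + m • Pi.single l 1) ≤ (1 + |(m : ℝ)|) * jb ξ := by
  have hjb : jb ξ ^ 2 = 1 + ∑ j, (ξ j : ℝ) ^ 2 := by
    rw [jb, Real.sq_sqrt]
    exact add_nonneg zero_le_one (Finset.sum_nonneg fun j _ => sq_nonneg _)
  have h1 := one_le_jb ξ
  have h2 := abs_le_jb ξ l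
  refine Real.sqrt_le_iff.2 ⟨by positivity, ?_⟩
  have hs : ∑ j, (((ξ + m • Pi.single l 1 : Fin n → ℤ) j : ℤ) : ℝ) ^ 2
      = ∑ j, (ξ j : ℝ) ^ 2 + (2 * m * ξ l + (m : ℝ) ^ 2) := by
    have : ∀ j, (((ξ + m • Pi.single l 1 : Fin n → ℤ) j : ℤ) : ℝ) ^ 2
        = (ξ j : ℝ) ^ 2 + if j = l then (2 * m * ξ l + (m : ℝ) ^ 2) else 0 := by
      intro j
      by_cases hj : j = l
      · subst hj; simp; ring
      · simp [hj]
    simp only [this, Finset.sum_add_distrib, Finset.sum_ite_eq', Finset.mem_univ, if_true]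
  rw [hs, mul_pow, ← add_assoc, ← hjb]
  have h3 : (m : ℝ) * ξ l ≤ |(m : ℝ)| * jb ξ :=
    (le_abs_self _).trans (by rw [abs_mul]; gcongr)
  have h4 : |(m : ℝ)| ^ 2 = (m : ℝ) ^ 2 := sq_abs _
  have h5 : 0 ≤ |(m : ℝ)| := abs_nonneg _
  nlinarith [mul_nonneg h5 (mul_nonneg (by linarith : 0 ≤ jb ξ) (sub_nonneg.2 h1)),
    mul_nonneg (sq_nonneg (m : ℝ)) (by nlinarith : 0 ≤ jb ξ ^ 2 - 1)]

lemma exists_bump : ∃ χ : ℝ → ℂ, ContDiff ℝ (⊤ : ℕ∞) χ ∧ HasCompactSupport χ ∧ (∀ t, ‖χ t‖ ≤ 1) ∧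
    (∀ t, |t| ≤ 1 → χ t = 1) ∧ ∀ t, 2 ≤ |t| → χ t = 0 := by
  let χ : ContDiffBump (0 : ℝ) := ⟨1, 2, one_pos, one_lt_two⟩
  refine ⟨fun t => (χ t : ℂ), Complex.ofRealCLM.contDiff.comp χ.contDiff,
    χ.hasCompactSupport.comp_left Complex.ofReal_zero, fun t => ?_, fun t ht => ?_, fun t ht => ?_⟩
  · rw [Complex.norm_real, Real.norm_of_nonneg χ.nonneg]
    exact χ.le_one
  · beta_reduce
    rw [χ.one_of_mem_closedBall (by simpa [Real.dist_eq] using ht), Complex.ofReal_one]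
  · beta_reduce
    rw [χ.zero_of_le_dist (by simpa [Real.dist_eq] using ht), Complex.ofReal_zero]

/-- Smooth cutoffs to the cubes `|ξ| ≤ 2 ^ (J + 1)`. -/
lemma exists_cutoff (n k : ℕ) : ∃ D : ℝ, 0 < D ∧ ∃ Φ : ℕ → (Fin n → ℤ) → ℂ,
    (∀ J ξ, Φ J ξ ≠ 0 → ∀ m, |(ξ m : ℝ)| ≤ 2 ^ (J + 1)) ∧
    (∀ J ξ, (∀ m, |(ξ m : ℝ)| ≤ 2 ^ J) → Φ J ξ = 1) ∧ (∀ J ξ, ‖Φ J ξ‖ ≤ 1) ∧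
    ∀ J l, ∀ i ≤ k, ∀ ξ, ‖(dd l)^[i] (Φ J) ξ‖ ≤ D * ((2 ^ J)⁻¹) ^ i := by
  obtain ⟨χ, hsm, hcs, hle, hone, hzero⟩ := exists_bump
  have hle' : ∀ i : ℕ, ((i : ℕ) : WithTop ℕ∞) ≤ ((⊤ : ℕ∞) : WithTop ℕ∞) := fun i => by
    exact_mod_cast le_top
  have hB : ∀ i : ℕ, ∃ B, ∀ t, ‖iteratedDeriv i χ t‖ ≤ B := by
    intro i
    obtain ⟨B, hB⟩ := (hcs.iteratedFDeriv (𝕜 := ℝ) i).exists_bound_of_continuous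
      (hsm.continuous_iteratedFDeriv (hle' i))
    exact ⟨B, fun t => by rw [← norm_iteratedFDeriv_eq_norm_iteratedDeriv]; exact hB t⟩
  choose B hB using hB
  have hB0 : ∀ i, 0 ≤ B i := fun i => (norm_nonneg _).trans (hB i 0)
  have hsum0 : 0 ≤ ∑ i ∈ Finset.range (k + 1), B i := Finset.sum_nonneg fun i _ => hB0 i
  refine ⟨1 + ∑ i ∈ Finset.range (k + 1), B i, by linarith,
    fun J ξ => ∏ m, χ (ξ m * (2 ^ J)⁻¹), ?_, ?_, ?_, ?_⟩
  · intro J ξ h m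
    by_contra! hm
    refine h (Finset.prod_eq_zero (Finset.mem_univ m) (hzero _ ?_))
    rw [abs_mul, abs_inv, abs_of_pos (by positivity : (0 : ℝ) < 2 ^ J), ← div_eq_mul_inv,
      le_div_iff₀ (by positivity), ← pow_succ']
    exact hm.le
  · intro J ξ h
    refine Finset.prod_eq_one fun m _ => hone _ ?_
    rw [abs_mul, abs_inv, abs_of_pos (by positivity : (0 : ℝ) < 2 ^ J), ← div_eq_mul_inv,
      div_le_one (by positivity)]
    exact h m
  · intro J ξ
    rw [norm_prod]
    exact Finset.prod_le_one (fun m _ => norm_nonneg _) fun m _ => hle _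
  · intro J l i hi ξ
    have h1 : (fun ξ : Fin n → ℤ => ∏ m, χ (ξ m * (2 ^ J)⁻¹))
        = fun ξ => (∏ m ∈ Finset.univ.erase l, χ (ξ m * (2 ^ J)⁻¹)) * χ (ξ l * (2 ^ J)⁻¹) :=
      funext fun ξ => (Finset.prod_erase_mul _ _ (Finset.mem_univ l)).symm
    beta_reduce
    rw [h1, iterate_dd_mul_comp
      (c := fun ξ => ∏ m ∈ Finset.univ.erase l, χ (ξ m * (2 ^ J)⁻¹))]
    · rw [norm_mul]
      have h2 : ‖∏ m ∈ Finset.univ.erase l, χ (ξ m * (2 ^ J)⁻¹)‖ ≤ 1 := by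
        rw [norm_prod]
        exact Finset.prod_le_one (fun m _ => norm_nonneg _) fun m _ => hle _
      have h3 := norm_iterate_fwdDiff_le (h := (2 ^ J)⁻¹) (by positivity) i hsm (hB i)
        (ξ l * (2 ^ J)⁻¹)
      have h4 := Finset.single_le_sum (f := B) (fun i _ => hB0 i)
        (Finset.mem_range.2 (Nat.lt_succ_of_le hi))
      calc _ ≤ 1 * (B i * ((2 ^ J)⁻¹) ^ i) :=
            mul_le_mul h2 h3 (norm_nonneg _) zero_le_one
        _ ≤ _ := by
            rw [one_mul]
            gcongr
            linarith
    · intro ξ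
      refine Finset.prod_congr rfl fun m hm => ?_
      rw [Pi.add_apply, Pi.single_eq_of_ne (Finset.ne_of_mem_erase hm), add_zero]

/-- A smooth dyadic partition of unity on `ℤⁿ`. -/
lemma exists_dyadic_partition (n k : ℕ) : ∃ D : ℝ, 0 < D ∧ ∃ φ : ℕ → (Fin n → ℤ) → ℂ,
    (∀ j ξ, φ j ξ ≠ 0 → (∀ m, |(ξ m : ℝ)| ≤ 2 ^ (j + 1)) ∧ 2 ^ j ≤ 2 * jb ξ) ∧
    (∀ j l, ∀ i ≤ k, ∀ ξ, ‖(dd l)^[i] (φ j) ξ‖ ≤ D * ((2 ^ j)⁻¹) ^ i) ∧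
    (∀ J ξ, ‖∑ j ∈ Finset.range (J + 1), φ j ξ‖ ≤ 1) ∧
    ∀ ξ, ∀ᶠ J in Filter.atTop, ∑ j ∈ Finset.range (J + 1), φ j ξ = 1 := by
  obtain ⟨D, hD, Φ, hsupp, hone, hle, hdd⟩ := exists_cutoff n k
  let φ : ℕ → (Fin n → ℤ) → ℂ := fun j => if j = 0 then Φ 0 else Φ j - Φ (j - 1)
  have hsum : ∀ J ξ, ∑ j ∈ Finset.range (J + 1), φ j ξ = Φ J ξ := by
    intro J ξ
    induction J with
    | zero => simp [φ]
    | succ J ih => rw [Finset.sum_range_succ, ih]; simp [φ]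
  refine ⟨D * (1 + 2 ^ k), by positivity, φ, ?_, ?_, ?_, ?_⟩
  · rintro (_ | j) ξ h
    · refine ⟨hsupp 0 ξ (by simpa [φ] using h), ?_⟩
      have := one_le_jb ξ
      linarith [pow_zero (2 : ℝ)]
    · have h' : Φ (j + 1) ξ - Φ j ξ ≠ 0 := by simpa [φ] using h
      constructor
      · by_cases h1 : Φ (j + 1) ξ = 0
        · intro m
          refine (hsupp j ξ (fun h2 => h' (by rw [h1, h2, sub_zero])) m).trans ?_
          exact pow_le_pow_right₀ one_le_two (by omega)
        · exact hsupp _ ξ h1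
      · by_contra! hlt
        have hsmall : ∀ m, |(ξ m : ℝ)| ≤ 2 ^ j := fun m =>
          (abs_le_jb ξ m).trans (by rw [pow_succ'] at hlt; linarith)
        refine h' ?_
        rw [hone j ξ hsmall, hone (j + 1) ξ fun m => (hsmall m).trans
          (pow_le_pow_right₀ one_le_two (by omega)), sub_self]
  · rintro (_ | j) l i hi ξ
    · have h1 : φ 0 = Φ 0 := by simp [φ]
      rw [h1]
      refine (hdd 0 l i hi ξ).trans ?_
      gcongr
      have : (0 : ℝ) < 2 ^ k := by positivity
      nlinarith
    · have h1 : φ (j + 1) = Φ (j + 1) - Φ j := by simp [φ]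
      rw [h1, iterate_dd_sub]
      refine (norm_sub_le _ _).trans ?_
      have h2 := hdd (j + 1) l i hi ξ
      have h3 := hdd j l i hi ξ
      have h4 : ((2 : ℝ) ^ j)⁻¹ ^ i = 2 ^ i * (((2 : ℝ) ^ (j + 1))⁻¹) ^ i := by
        rw [← mul_pow]
        congr 1
        rw [pow_succ]
        field_simp
      have h5 : (2 : ℝ) ^ i ≤ 2 ^ k := pow_le_pow_right₀ one_le_two hi
      calc _ ≤ D * (((2 : ℝ) ^ (j + 1))⁻¹) ^ i + D * (2 ^ i * (((2 : ℝ) ^ (j + 1))⁻¹) ^ i) :=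
            add_le_add h2 (h4 ▸ h3)
        _ ≤ D * (((2 : ℝ) ^ (j + 1))⁻¹) ^ i + D * (2 ^ k * (((2 : ℝ) ^ (j + 1))⁻¹) ^ i) := by
            gcongr
        _ = _ := by ring
  · intro J ξ
    rw [hsum]
    exact hle J ξ
  · intro ξ
    simp only [hsum]
    obtain ⟨J₀, hJ₀⟩ := pow_unbounded_of_one_lt (jb ξ) (one_lt_two : (1 : ℝ) < 2)
    filter_upwards [Filter.eventually_ge_atTop J₀] with J hJ
    exact hone J ξ fun m => (abs_le_jb ξ m).trans
      (hJ₀.le.trans (pow_le_pow_right₀ one_le_two hJ))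

end Cutoffs

section Symbols

variable {n : ℕ}

lemma mIdxList_single (l : Fin n) (i : ℕ) : mIdxList (Pi.single l i) = List.replicate i l := by
  rw [List.eq_replicate_iff]
  constructor
  · rw [mIdxList, List.length_flatMap]
    simp only [List.length_replicate]
    rw [← Fin.sum_univ_def, Finset.sum_pi_single']
    simp
  · intro b hb
    obtain ⟨j, -, hj⟩ := List.mem_flatMap.1 hb
    obtain ⟨h0, rfl⟩ := List.mem_replicate.1 hj
    by_contra hne
    exact h0 (Pi.single_eq_of_ne hne _)

lemma foldr_replicate_eq_iterate {α β : Type*} (f : α → β → β) (a : α) (i : ℕ) (b : β) :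
    (List.replicate i a).foldr f b = (f a)^[i] b := by
  induction i with
  | zero => rfl
  | succ i ih => rw [List.replicate_succ, List.foldr_cons, ih, Function.iterate_succ_apply']

lemma ddM_single (l : Fin n) (i : ℕ) (g : (Fin n → ℤ) → ℂ) :
    ddM (Pi.single l i) g = (dd l)^[i] g := by
  rw [ddM, mIdxList_single, foldr_replicate_eq_iterate]

lemma pdM_single (l : Fin n) (i : ℕ) (f : (Fin n → ℝ) → ℂ) :
    pdM (Pi.single l i) f = (pd l)^[i] f := by
  rw [pdM, mIdxList_single, foldr_replicate_eq_iterate]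

lemma le_jb_of_le_jb_add {k t₀ t : ℕ} (ht₀ : t₀ ≤ k) (ht : t ≤ k) {ξ : Fin n → ℤ} {l : Fin n}
    {X : ℝ} (h : X ≤ 2 * jb (ξ + t₀ • Pi.single l 1)) :
    (2 * (1 + k : ℝ))⁻¹ * X ≤ jb (ξ + t • Pi.single l 1) := by
  have h1 := jb_add_zsmul_le (ξ + t • Pi.single l 1) l ((t₀ : ℤ) - t)
  have h2 : ξ + t • Pi.single l 1 + ((t₀ : ℤ) - t) • (Pi.single l 1 : Fin n → ℤ)
      = ξ + t₀ • Pi.single l 1 := by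
    rw [add_assoc, ← natCast_zsmul (Pi.single l 1 : Fin n → ℤ) t, ← add_smul,
      add_sub_cancel, natCast_zsmul]
  rw [h2] at h1
  have h3 : |(((t₀ : ℤ) - t : ℤ) : ℝ)| ≤ k := by
    have : |(t₀ : ℤ) - t| ≤ k := by rw [abs_le]; omega
    exact_mod_cast this
  have h4 : jb (ξ + t₀ • Pi.single l 1) ≤ (1 + k) * jb (ξ + t • Pi.single l 1) := by
    refine h1.trans (mul_le_mul_of_nonneg_right (by linarith) ?_)
    linarith [one_le_jb (ξ + t • Pi.single l 1)]
  rw [inv_mul_le_iff₀ (by positivity)]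
  linarith

/-- Differences of a dyadic piece of a symbol of order `-κ` and type `δ`. -/
lemma norm_iterate_dd_localized_le {k : ℕ} {κ δ A D : ℝ} (hκ : 0 ≤ κ) (hδ0 : 0 ≤ δ) (hδ1 : δ ≤ 1)
    (hA : 0 ≤ A) (hD : 0 ≤ D) {a φ : (Fin n → ℤ) → ℂ} {l : Fin n} {j : ℕ}
    (ha : ∀ i ≤ k, ∀ ξ, ‖(dd l)^[i] a ξ‖ ≤ A * jb ξ ^ (-κ - δ * i))
    (hsupp : ∀ ξ, φ ξ ≠ 0 → 2 ^ j ≤ 2 * jb ξ)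
    (hφ : ∀ i ≤ k, ∀ ξ, ‖(dd l)^[i] φ ξ‖ ≤ D * ((2 ^ j)⁻¹) ^ i) (ξ : Fin n → ℤ) :
    (((2 : ℝ) ^ j) ^ δ) ^ k * ‖(dd l)^[k] (fun ξ => φ ξ * a ξ) ξ‖
      ≤ 2 ^ k * (D * (A * (2 * (1 + k : ℝ)) ^ (κ + k))) * ((2 : ℝ) ^ j) ^ (-κ) := by
  set X : ℝ := 2 ^ j with hX
  have hX1 : 1 ≤ X := one_le_pow₀ one_le_two
  have hX0 : 0 < X := by linarith
  by_cases hz : ∀ t ≤ k, φ (ξ + t • Pi.single l 1) = 0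
  · rw [iterate_dd_eq_zero fun t ht => by rw [hz t ht, zero_mul], norm_zero, mul_zero]
    positivity
  push Not at hz
  obtain ⟨t₀, ht₀, hne⟩ := hz
  have hjb : ∀ t ≤ k, (2 * (1 + k : ℝ))⁻¹ * X ≤ jb (ξ + t • Pi.single l 1) := fun t ht =>
    le_jb_of_le_jb_add ht₀ ht (hsupp _ hne)
  set c : ℝ := 2 * (1 + k) with hc
  have hc1 : 1 ≤ c := by
    have : (0 : ℝ) ≤ k := by positivity
    linarith
  have hac : ∀ i t, i + t ≤ k → ‖(dd l)^[i] a (ξ + t • Pi.single l 1)‖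
      ≤ (A * c ^ (κ + k) * X ^ (-κ)) * (X ^ (-δ)) ^ i := by
    intro i t hit
    have hi : (i : ℝ) ≤ k := by exact_mod_cast (by omega : i ≤ k)
    calc _ ≤ A * jb (ξ + t • Pi.single l 1) ^ (-κ - δ * i) := ha i (by omega) _
      _ ≤ A * (c⁻¹ * X) ^ (-κ - δ * i) := by
          refine mul_le_mul_of_nonneg_left ?_ hA
          refine Real.rpow_le_rpow_of_nonpos (by positivity) (hjb t (by omega)) ?_
          have : 0 ≤ δ * i := by positivity
          linarith
      _ = A * (c ^ (κ + δ * i) * (X ^ (-κ) * (X ^ (-δ)) ^ i)) := by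
          rw [Real.mul_rpow (by positivity) hX0.le, Real.inv_rpow (by positivity),
            ← Real.rpow_neg (by positivity), ← Real.rpow_mul_natCast hX0.le, ← Real.rpow_add hX0]
          congr 3 <;> ring_nf
      _ ≤ A * (c ^ (κ + k) * (X ^ (-κ) * (X ^ (-δ)) ^ i)) := by
          gcongr
          calc δ * i ≤ 1 * k := by gcongr
            _ = k := one_mul _
      _ = _ := by ring
  have hφc : ∀ i t, i + t ≤ k → ‖(dd l)^[i] φ (ξ + t • Pi.single l 1)‖ ≤ D * (X ^ (-δ)) ^ i := by
    intro i t hit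
    refine (hφ i (by omega) _).trans ?_
    gcongr
    rw [← Real.rpow_neg_one]
    exact Real.rpow_le_rpow_of_exponent_le hX1 (by linarith)
  have h := norm_iterate_dd_mul_le hφc hac
  have hinv : (X ^ δ) ^ k * (X ^ (-δ)) ^ k = 1 := by
    rw [← mul_pow, ← Real.rpow_add hX0, add_neg_cancel, Real.rpow_zero, one_pow]
  calc _ ≤ (X ^ δ) ^ k * (2 ^ k * (D * (A * c ^ (κ + k) * X ^ (-κ))) * (X ^ (-δ)) ^ k) := by
        gcongr
    _ = ((X ^ δ) ^ k * (X ^ (-δ)) ^ k) * (2 ^ k * (D * (A * c ^ (κ + k))) * X ^ (-κ)) := by ring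
    _ = _ := by rw [hinv, one_mul]

/-- The finite set of frequencies carrying the `j`-th dyadic piece and its differences up to
order `k`. -/
def dyadicBox (n k j : ℕ) : Finset (Fin n → ℤ) :=
  Fintype.piFinset fun _ => Finset.Icc (-(2 ^ (j + 1) + k : ℤ)) (2 ^ (j + 1) + k)

lemma card_dyadicBox_le (n k j : ℕ) :
    ((dyadicBox n k j).card : ℝ) ≤ ((2 * k + 5) * 2 ^ j) ^ n := by
  rw [dyadicBox, Fintype.card_piFinset_const, Int.card_Icc]
  have h1 : (((2 : ℤ) ^ (j + 1) + k + 1 - -(2 ^ (j + 1) + k)).toNat : ℤ)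
      = 2 * (2 ^ (j + 1) + k) + 1 := by
    have h0 : (0 : ℤ) < 2 ^ (j + 1) := by positivity
    omega
  have h2 : (((2 : ℤ) ^ (j + 1) + k + 1 - -(2 ^ (j + 1) + k)).toNat : ℝ)
      = 2 * (2 ^ (j + 1) + k) + 1 := by exact_mod_cast h1
  push_cast [h2]
  refine pow_le_pow_left₀ (by positivity) ?_ n
  have h3 : (1 : ℝ) ≤ 2 ^ j := one_le_pow₀ one_le_two
  have h4 : (0 : ℝ) ≤ k := by positivity
  rw [pow_succ]
  nlinarith

lemma mem_dyadicBox {k j t : ℕ} (ht : t ≤ k) {ξ : Fin n → ℤ} {l : Fin n}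
    (h : ∀ m, |(((ξ + t • Pi.single l 1 : Fin n → ℤ) m : ℤ) : ℝ)| ≤ 2 ^ (j + 1)) :
    ξ ∈ dyadicBox n k j := by
  rw [dyadicBox, Fintype.mem_piFinset]
  intro m
  have h1 : |(ξ + t • Pi.single l 1 : Fin n → ℤ) m| ≤ 2 ^ (j + 1) := by exact_mod_cast h m
  rw [abs_le] at h1
  rw [Finset.mem_Icc]
  by_cases hm : m = l
  · subst hm
    simp only [Pi.add_apply, Pi.smul_apply, Pi.single_eq_same] at h1
    simp only [nsmul_eq_mul, mul_one] at h1
    omega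
  · simp only [Pi.add_apply, Pi.smul_apply, Pi.single_eq_of_ne hm, smul_zero, add_zero] at h1
    omega

end Symbols

section Assembly

variable {n : ℕ}

lemma fc_add {f g : (Fin n → ℝ) → ℂ} (hf : Measurable f) (hg : Measurable g)
    (hf' : ∃ B, ∀ x, ‖f x‖ ≤ B) (hg' : ∃ B, ∀ x, ‖g x‖ ≤ B) (ξ : Fin n → ℤ) :
    fc (f + g) ξ = fc f ξ + fc g ξ := by
  have h : ∀ {u : (Fin n → ℝ) → ℂ}, Measurable u → (∃ B, ∀ x, ‖u x‖ ≤ B) →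
      Integrable (fun x => eChar x (-ξ) * u x) (μT n) := by
    rintro u hu ⟨B, hB⟩
    refine integrable_of_bounded ((eChar_continuous_left _).measurable.mul hu) (B := B) fun x => ?_
    rw [norm_mul, norm_eChar, one_mul]
    exact hB x
  simp only [fc_eq, Pi.add_apply, mul_add]
  exact integral_add (h hf hf') (h hg hg')

lemma finOp_add (F : Finset (Fin n → ℤ)) (s : (Fin n → ℝ) → (Fin n → ℤ) → ℂ)
    {f g : (Fin n → ℝ) → ℂ} (hf : Measurable f) (hg : Measurable g)
    (hf' : ∃ B, ∀ x, ‖f x‖ ≤ B) (hg' : ∃ B, ∀ x, ‖g x‖ ≤ B) (x : Fin n → ℝ) :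
    finOp F s (f + g) x = finOp F s f x + finOp F s g x := by
  simp only [finOp, fc_add hf hg hf' hg', mul_add, Finset.sum_add_distrib]

lemma continuous_finOp (F : Finset (Fin n → ℤ)) {s : (Fin n → ℝ) → (Fin n → ℤ) → ℂ}
    (hs : ∀ ξ, Continuous fun x => s x ξ) (f : (Fin n → ℝ) → ℂ) : Continuous (finOp F s f) :=
  continuous_finsetSum _ fun ξ _ => ((eChar_continuous_left ξ).mul (hs ξ)).mul continuous_const

/-- The pointwise symbol estimates in coordinate directions, with a uniform constant. -/
lemma exists_symbol_bound (hn : 1 ≤ n) {k : ℕ} {κ δ : ℝ} {a : (Fin n → ℝ) → (Fin n → ℤ) → ℂ}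
    (ha₁ : ∀ α : Fin n → ℕ, (∑ j, α j) ≤ k → ∃ C : ℝ, 0 < C ∧ ∀ (x : Fin n → ℝ) (ξ : Fin n → ℤ),
      ‖ddM α (a x) ξ‖ ≤ C * jb ξ ^ (-κ - δ * ∑ j, (α j : ℝ)))
    (ha₂ : ∀ β : Fin n → ℕ, (∑ j, β j) ≤ k → ∃ C : ℝ, 0 < C ∧ ∀ (x : Fin n → ℝ) (ξ : Fin n → ℤ),
      ‖pdM β (fun x' => a x' ξ) x‖ ≤ C * jb ξ ^ (-κ)) :
    ∃ A : ℝ, 0 < A ∧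
      (∀ l, ∀ i ≤ k, ∀ x ξ, ‖(dd l)^[i] (a x) ξ‖ ≤ A * jb ξ ^ (-κ - δ * i)) ∧
      (∀ x ξ, ‖a x ξ‖ ≤ A * jb ξ ^ (-κ)) ∧
      ∀ l x ξ, ‖(pd l)^[k] (fun x => a x ξ) x‖ ≤ A * jb ξ ^ (-κ) := by
  have h₁ : ∀ z : Fin n × Fin (k + 1), ∃ C : ℝ, 0 < C ∧ ∀ x ξ,
      ‖(dd z.1)^[z.2] (a x) ξ‖ ≤ C * jb ξ ^ (-κ - δ * (z.2 : ℕ)) := by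
    intro z
    obtain ⟨C, hC, h⟩ := ha₁ (Pi.single z.1 z.2) (by
      rw [Finset.sum_pi_single']; simpa using Nat.lt_succ_iff.1 z.2.2)
    refine ⟨C, hC, fun x ξ => ?_⟩
    have h2 := h x ξ
    rw [ddM_single, ← Nat.cast_sum, Finset.sum_pi_single'] at h2
    simpa using h2
  have h₂ : ∀ l : Fin n, ∃ C : ℝ, 0 < C ∧ ∀ x ξ,
      ‖(pd l)^[k] (fun x => a x ξ) x‖ ≤ C * jb ξ ^ (-κ) := by
    intro l
    obtain ⟨C, hC, h⟩ := ha₂ (Pi.single l k) (by rw [Finset.sum_pi_single']; simp)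
    refine ⟨C, hC, fun x ξ => ?_⟩
    have h2 := h x ξ
    rwa [pdM_single] at h2
  choose C₁ hC₁ h₁ using h₁
  choose C₂ hC₂ h₂ using h₂
  have hle₁ : ∀ z, C₁ z ≤ 1 + ∑ z, C₁ z + ∑ l, C₂ l := fun z => by
    have e1 := Finset.single_le_sum (fun z _ => (hC₁ z).le) (Finset.mem_univ z)
    have e2 := Finset.sum_nonneg fun l (_ : l ∈ Finset.univ) => (hC₂ l).le
    linarith
  have hle₂ : ∀ l, C₂ l ≤ 1 + ∑ z, C₁ z + ∑ l, C₂ l := fun l => by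
    have e1 := Finset.single_le_sum (fun l _ => (hC₂ l).le) (Finset.mem_univ l)
    have e2 := Finset.sum_nonneg fun z (_ : z ∈ Finset.univ) => (hC₁ z).le
    linarith
  have hjb : ∀ (ξ : Fin n → ℤ) (t : ℝ), 0 ≤ jb ξ ^ t := fun ξ t =>
    Real.rpow_nonneg (by linarith [one_le_jb ξ]) t
  have hdd : ∀ l, ∀ i ≤ k, ∀ x ξ,
      ‖(dd l)^[i] (a x) ξ‖ ≤ (1 + ∑ z, C₁ z + ∑ l, C₂ l) * jb ξ ^ (-κ - δ * i) := fun l i hi x ξ =>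
    (h₁ (l, ⟨i, Nat.lt_succ_iff.2 hi⟩) x ξ).trans
      (mul_le_mul_of_nonneg_right (hle₁ _) (hjb _ _))
  refine ⟨1 + ∑ z, C₁ z + ∑ l, C₂ l, ?_, hdd, fun x ξ => ?_, fun l x ξ =>
    (h₂ l x ξ).trans (mul_le_mul_of_nonneg_right (hle₂ _) (hjb _ _))⟩
  · have e1 := Finset.sum_nonneg fun z (_ : z ∈ Finset.univ) => (hC₁ z).le
    have e2 := Finset.sum_nonneg fun l (_ : l ∈ Finset.univ) => (hC₂ l).le
    linarith
  · simpa using hdd ⟨0, hn⟩ 0 (Nat.zero_le _) x ξ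

lemma norm_mul_le_of_localized {κ A D X : ℝ} (hκ : 0 ≤ κ) (hA : 0 ≤ A) (hD : 0 ≤ D) (hX : 0 < X)
    {c z : ℂ} {ξ : Fin n → ℤ} (hc : c ≠ 0 → X ≤ 2 * jb ξ) (hcD : ‖c‖ ≤ D)
    (hz : ‖z‖ ≤ A * jb ξ ^ (-κ)) : ‖c * z‖ ≤ D * (A * 2 ^ κ) * X ^ (-κ) := by
  by_cases h0 : c = 0
  · rw [h0, zero_mul, norm_zero]; positivity
  have h1 : jb ξ ^ (-κ) ≤ (2⁻¹ * X) ^ (-κ) :=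
    Real.rpow_le_rpow_of_nonpos (by positivity) (by linarith [hc h0]) (by linarith)
  rw [Real.mul_rpow (by norm_num) hX.le, Real.inv_rpow (by norm_num),
    Real.rpow_neg zero_le_two κ, inv_inv] at h1
  calc ‖c * z‖ ≤ D * (A * jb ξ ^ (-κ)) := by rw [norm_mul]; gcongr
    _ ≤ D * (A * (2 ^ κ * X ^ (-κ))) := by gcongr
    _ = _ := by ring

/-- `L^p` estimate for the dyadic pieces of a pseudo-differential operator. -/
lemma exists_lintegral_dyadic_le (hn : 1 ≤ n) {k : ℕ} (hk : n < 2 * k) {p κ δ A D : ℝ} (hp : 2 ≤ p)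
    (hκ : 0 ≤ κ) (hδ0 : 0 ≤ δ) (hδ1 : δ ≤ 1) (hκδ : 2 * κ + n * δ = n) (hA : 0 < A) (hD : 0 < D)
    {a : (Fin n → ℝ) → (Fin n → ℤ) → ℂ} (ha_smooth : ∀ ξ, ContDiff ℝ (⊤ : ℕ∞) fun x => a x ξ)
    (ha_per : ∀ ξ, Per fun x => a x ξ)
    (ha_dd : ∀ l, ∀ i ≤ k, ∀ x ξ, ‖(dd l)^[i] (a x) ξ‖ ≤ A * jb ξ ^ (-κ - δ * i))
    (ha_le : ∀ x ξ, ‖a x ξ‖ ≤ A * jb ξ ^ (-κ))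
    (ha_pd : ∀ l x ξ, ‖(pd l)^[k] (fun x => a x ξ) x‖ ≤ A * jb ξ ^ (-κ))
    {φ : ℕ → (Fin n → ℤ) → ℂ}
    (hsupp : ∀ j ξ, φ j ξ ≠ 0 → (∀ m, |(ξ m : ℝ)| ≤ 2 ^ (j + 1)) ∧ 2 ^ j ≤ 2 * jb ξ)
    (hφ : ∀ j l, ∀ i ≤ k, ∀ ξ, ‖(dd l)^[i] (φ j) ξ‖ ≤ D * ((2 ^ j)⁻¹) ^ i) :
    ∃ E : ℝ≥0∞, E ≠ ⊤ ∧ ∀ (j : ℕ) (f : (Fin n → ℝ) → ℂ) (B : ℝ), Measurable f → (∀ x, ‖f x‖ ≤ B) →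
      ∫⁻ x, ‖finOp (dyadicBox n k j) (fun x ξ => φ j ξ * a x ξ) f x‖ₑ ^ p ∂(μT n)
        ≤ E * ENNReal.ofReal (((2 : ℝ) ^ j) ^ (-(2 * κ))) * ∫⁻ x, ‖f x‖ₑ ^ p ∂(μT n) := by
  obtain ⟨C₂, hC₂, htwo⟩ := exists_lintegral_finOp_sq_le (n := n) hk
  obtain ⟨C₃, hC₃, hinfty⟩ := exists_norm_finOp_le hn hk
  obtain ⟨C₄, hC₄, hinterp⟩ := exists_lintegral_rpow_le (μ := μT n) hp
  set K : ℝ := 2 ^ k * (D * (A * (2 * (1 + k : ℝ)) ^ (κ + k))) + D * (A * 2 ^ κ) with hK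
  have hK0 : 0 < K := by positivity
  set M : ℝ := √((2 * k + 5) ^ n) * K with hM
  have hM0 : 0 < M := by positivity
  refine ⟨C₄ * (C₂ * ENNReal.ofReal (K ^ 2)) * ENNReal.ofReal (((C₃ + 1) * M) ^ (p - 2)),
    by finiteness, fun j f B hf hB => ?_⟩
  set X : ℝ := 2 ^ j with hX
  have hX0 : 0 < X := by positivity
  set s : (Fin n → ℝ) → (Fin n → ℤ) → ℂ := fun x ξ => φ j ξ * a x ξ with hs
  have hs_smooth : ∀ ξ, ContDiff ℝ (⊤ : ℕ∞) fun x => s x ξ := fun ξ =>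
    contDiff_const.mul (ha_smooth ξ)
  have hs_per : ∀ ξ, Per fun x => s x ξ := fun ξ x v => congrArg (φ j ξ * ·) (ha_per ξ x v)
  have hφD : ∀ ξ, ‖φ j ξ‖ ≤ D := fun ξ => by simpa using hφ j ⟨0, hn⟩ 0 (Nat.zero_le _) ξ
  have hXκ : 0 ≤ X ^ (-κ) := by positivity
  have hloc : ∀ {z : ℂ} {ξ : Fin n → ℤ}, ‖z‖ ≤ A * jb ξ ^ (-κ) → ‖φ j ξ * z‖ ≤ K * X ^ (-κ) := by
    intro z ξ hz
    refine (norm_mul_le_of_localized hκ hA.le hD.le hX0 (fun h => (hsupp j ξ h).2) (hφD ξ)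
      hz).trans (mul_le_mul_of_nonneg_right ?_ hXκ)
    exact le_add_of_nonneg_left (by positivity)
  have hs_le : ∀ x ξ, ‖s x ξ‖ ≤ K * X ^ (-κ) := fun x ξ => hloc (ha_le x ξ)
  have hs_pd : ∀ l x ξ, ‖(pd l)^[k] (fun x => s x ξ) x‖ ≤ K * X ^ (-κ) := by
    intro l x ξ
    have h := congrFun (iterate_pd_sum {ξ} (φ j) ha_smooth ha_per l k) x
    simp only [Finset.sum_singleton] at h
    rw [hs, h]
    exact hloc (ha_pd l x ξ)
  have hs_dd : ∀ x l ξ, (X ^ δ) ^ k * ‖(dd l)^[k] (s x) ξ‖ ≤ K * X ^ (-κ) := by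
    intro x l ξ
    refine (norm_iterate_dd_localized_le hκ hδ0 hδ1 hA.le hD.le (fun i hi ξ => ha_dd l i hi x ξ)
      (fun ξ h => (hsupp j ξ h).2) (hφ j l) ξ).trans (mul_le_mul_of_nonneg_right ?_ hXκ)
    exact le_add_of_nonneg_right (by positivity)
  have hs_dd_supp : ∀ x l, ∀ i ≤ k, ((dd l)^[i] (s x)).support ⊆ dyadicBox n k j := by
    intro x l i hi ξ hξ
    by_contra hmem
    refine hξ (iterate_dd_eq_zero fun t ht => ?_)
    by_contra hne
    exact hmem (mem_dyadicBox (ht.trans hi) (hsupp j _ (left_ne_zero_of_mul hne)).1)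
  have hcard : ((dyadicBox n k j).card : ℝ) * (K * X ^ (-κ)) ^ 2 ≤ M ^ 2 * (X ^ δ) ^ n := by
    have h1 : X ^ n * (X ^ (-κ)) ^ 2 = (X ^ δ) ^ n := by
      rw [← Real.rpow_natCast X n, ← Real.rpow_mul_natCast hX0.le, ← Real.rpow_mul_natCast hX0.le,
        ← Real.rpow_add hX0]
      congr 1
      push_cast
      linarith
    calc _ ≤ ((2 * k + 5) * X) ^ n * (K * X ^ (-κ)) ^ 2 := by
          gcongr
          exact card_dyadicBox_le n k j
      _ = (2 * k + 5) ^ n * K ^ 2 * (X ^ n * (X ^ (-κ)) ^ 2) := by rw [mul_pow, mul_pow]; ring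
      _ = _ := by rw [h1, hM, mul_pow, Real.sq_sqrt (by positivity)]
  have henorm : ∀ {z : ℂ}, ‖z‖ ≤ K * X ^ (-κ) → ‖z‖ₑ ≤ ENNReal.ofReal (K * X ^ (-κ)) := by
    intro z hz
    rw [← ofReal_norm]
    exact ENNReal.ofReal_le_ofReal hz
  have h := hinterp (finOp (dyadicBox n k j) s) (C₂ * ENNReal.ofReal (K * X ^ (-κ)) ^ 2)
    ((C₃ + 1) * M) (by positivity)
    (fun f g x hf hg hf' hg' => finOp_add _ _ hf hg hf' hg' x)
    (fun f => (continuous_finOp _ (fun ξ => (hs_smooth ξ).continuous) f).measurable)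
    (fun f B hf hB => htwo _ s _ hs_smooth hs_per (fun x ξ => henorm (hs_le x ξ))
      (fun l x ξ => henorm (hs_pd l x ξ)) f B hf hB)
    (fun f B hf hB x => by
      have hB0 : 0 ≤ B := (norm_nonneg _).trans (hB x)
      refine (hinfty (dyadicBox n k j) s x (X ^ δ) (K * X ^ (-κ)) M (by positivity) hM0.le
        (by simpa using hs_dd_supp x ⟨0, hn⟩ 0 (Nat.zero_le _)) (fun l => hs_dd_supp x l k le_rfl)
        (hs_le x) (hs_dd x) hcard f B hf hB).trans ?_
      gcongr
      linarith) f B hf hB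
  refine h.trans (le_of_eq ?_)
  have h2 : ENNReal.ofReal (K * X ^ (-κ)) ^ 2
      = ENNReal.ofReal (K ^ 2) * ENNReal.ofReal (X ^ (-(2 * κ))) := by
    rw [← ENNReal.ofReal_pow (by positivity), ← ENNReal.ofReal_mul (by positivity), mul_pow,
      ← Real.rpow_mul_natCast hX0.le]
    congr 3
    push_cast
    ring
  rw [h2]
  ring

/-- Sums of operators whose `L^p` norms decay geometrically are uniformly bounded on `L^p`. -/
lemma eLpNorm'_sum_le_of_geometric {α : Type*} {_ : MeasurableSpace α} {μ : Measure α} {p κ : ℝ}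
    (hp : 1 ≤ p) {E I : ℝ≥0∞} {T : ℕ → α → ℂ}
    (hT : ∀ j, AEStronglyMeasurable (T j) μ)
    (h : ∀ j, ∫⁻ x, ‖T j x‖ₑ ^ p ∂μ ≤ E * ENNReal.ofReal (((2 : ℝ) ^ j) ^ (-κ)) * I) (J : ℕ) :
    eLpNorm' (∑ j ∈ Finset.range J, T j) p μ
      ≤ E ^ (1 / p) * (1 - ENNReal.ofReal (2 ^ (-κ / p)))⁻¹ * I ^ (1 / p) := by
  have hp0 : 0 ≤ 1 / p := by positivity
  refine (eLpNorm'_sum_le (fun j _ => hT j) hp).trans ?_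
  have h1 : ∀ j, eLpNorm' (T j) p μ ≤ ENNReal.ofReal (2 ^ (-κ / p)) ^ j * (E ^ (1 / p) * I ^ (1 / p)) := by
    intro j
    rw [eLpNorm'_eq_lintegral_enorm]
    refine (ENNReal.rpow_le_rpow (h j) hp0).trans (le_of_eq ?_)
    rw [ENNReal.mul_rpow_of_nonneg _ _ hp0, ENNReal.mul_rpow_of_nonneg _ _ hp0,
      ENNReal.ofReal_rpow_of_pos (by positivity), ← ENNReal.ofReal_pow (by positivity),
      ← Real.rpow_mul (by positivity), ← Real.rpow_natCast_mul (by norm_num),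
      ← Real.rpow_mul_natCast (by norm_num)]
    have e : (j : ℝ) * (-κ * (1 / p)) = -κ / p * j := by ring
    rw [e]
    ring
  calc _ ≤ ∑ j ∈ Finset.range J, ENNReal.ofReal (2 ^ (-κ / p)) ^ j * (E ^ (1 / p) * I ^ (1 / p)) :=
        Finset.sum_le_sum fun j _ => h1 j
    _ = (∑ j ∈ Finset.range J, ENNReal.ofReal (2 ^ (-κ / p)) ^ j) * (E ^ (1 / p) * I ^ (1 / p)) := by
        rw [Finset.sum_mul]
    _ ≤ (1 - ENNReal.ofReal (2 ^ (-κ / p)))⁻¹ * (E ^ (1 / p) * I ^ (1 / p)) := by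
        gcongr
        rw [← ENNReal.tsum_geometric]
        exact ENNReal.sum_le_tsum _
    _ = _ := by ring

end Assembly

section Main

open Filter Topology

variable {n : ℕ}

lemma tendsto_sum_finOp {F : ℕ → Finset (Fin n → ℤ)} {φ : ℕ → (Fin n → ℤ) → ℂ}
    (hF : ∀ j, (φ j).support ⊆ F j) (hle : ∀ J ξ, ‖∑ j ∈ Finset.range (J + 1), φ j ξ‖ ≤ 1)
    (hone : ∀ ξ, ∀ᶠ J in atTop, ∑ j ∈ Finset.range (J + 1), φ j ξ = 1)
    {a : (Fin n → ℝ) → (Fin n → ℤ) → ℂ} {f : (Fin n → ℝ) → ℂ} {x : Fin n → ℝ}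
    (hsum : Summable fun ξ => eChar x ξ * a x ξ * fc f ξ) :
    Tendsto (fun J => ∑ j ∈ Finset.range (J + 1), finOp (F j) (fun x ξ => φ j ξ * a x ξ) f x)
      atTop (𝓝 (Op a f x)) := by
  set g : (Fin n → ℤ) → ℂ := fun ξ => eChar x ξ * a x ξ * fc f ξ with hg
  have hz : ∀ j, ∀ ξ ∉ F j, φ j ξ * g ξ = 0 := fun j ξ hξ => by
    rw [Function.notMem_support.1 fun h => hξ (hF j h), zero_mul]
  have h1 : ∀ j, finOp (F j) (fun x ξ => φ j ξ * a x ξ) f x = ∑' ξ, φ j ξ * g ξ := fun j => by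
    rw [tsum_eq_sum (hz j)]
    exact Finset.sum_congr rfl fun ξ _ => by rw [hg]; ring
  have h2 : ∀ J, ∑ j ∈ Finset.range (J + 1), finOp (F j) (fun x ξ => φ j ξ * a x ξ) f x
      = ∑' ξ, (∑ j ∈ Finset.range (J + 1), φ j ξ) * g ξ := fun J => by
    simp only [h1, Finset.sum_mul]
    exact (Summable.tsum_finsetSum fun j _ => summable_of_ne_finset_zero (hz j)).symm
  simp only [h2]
  refine tendsto_tsum_of_dominated_convergence hsum.norm (fun ξ => ?_)
    (.of_forall fun J ξ => ?_)
  · refine tendsto_const_nhds.congr' ?_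
    filter_upwards [hone ξ] with J hJ
    rw [hJ, one_mul]
  · rw [norm_mul]
    exact mul_le_of_le_one_left (norm_nonneg _) (hle J ξ)

/-- Fatou's lemma for `L^r` bounds, allowing the limit function to vanish where convergence
fails. -/
lemma eLpNorm'_le_of_tendsto_or_eq_zero {α : Type*} {_ : MeasurableSpace α} {μ : Measure α} {r : ℝ}
    (hr : 0 < r) {S : ℕ → α → ℂ} {g : α → ℂ} (hS : ∀ J, Measurable (S J))
    (h : ∀ x, Tendsto (fun J => S J x) atTop (𝓝 (g x)) ∨ g x = 0) {K : ℝ≥0∞}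
    (hK : ∀ J, eLpNorm' (S J) r μ ≤ K) : eLpNorm' g r μ ≤ K := by
  have h1 : ∀ x, ‖g x‖ₑ ^ r ≤ liminf (fun J => ‖S J x‖ₑ ^ r) atTop := by
    intro x
    rcases h x with hx | hx
    · exact (((ENNReal.continuous_rpow_const.tendsto _).comp hx.enorm).liminf_eq).ge
    · simp [hx, hr]
  have h2 : ∀ J, ∫⁻ x, ‖S J x‖ₑ ^ r ∂μ ≤ K ^ r := by
    intro J
    rw [← ENNReal.rpow_inv_le_iff hr, ← one_div, ← eLpNorm'_eq_lintegral_enorm]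
    exact hK J
  rw [eLpNorm'_eq_lintegral_enorm, one_div, ENNReal.rpow_inv_le_iff hr]
  calc ∫⁻ x, ‖g x‖ₑ ^ r ∂μ ≤ ∫⁻ x, liminf (fun J => ‖S J x‖ₑ ^ r) atTop ∂μ := lintegral_mono h1
    _ ≤ liminf (fun J => ∫⁻ x, ‖S J x‖ₑ ^ r ∂μ) atTop :=
        lintegral_liminf_le fun J => (hS J).enorm.pow_const r
    _ ≤ liminf (fun _ : ℕ => K ^ r) atTop := liminf_le_liminf (.of_forall h2)
    _ = K ^ r := liminf_const _

lemma lpT_le_toReal_eLpNorm' {r : ℝ} (hr : 0 < r) (g : (Fin n → ℝ) → ℂ) :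
    lpT n r g ≤ (eLpNorm' g r (μT n)).toReal := by
  have h1 : ∀ x, ENNReal.ofReal ‖‖g x‖ ^ r‖ = ‖g x‖ₑ ^ r := fun x => by
    rw [Real.norm_of_nonneg (by positivity), ← ENNReal.ofReal_rpow_of_nonneg (norm_nonneg _) hr.le,
      ofReal_norm]
  have h2 := norm_integral_le_lintegral_norm (μ := μT n) fun x => ‖g x‖ ^ r
  simp only [h1] at h2
  have h3 : 0 ≤ ∫ x, ‖g x‖ ^ r ∂(μT n) := integral_nonneg fun x => by positivity
  rw [Real.norm_of_nonneg h3] at h2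
  rw [lpT, eLpNorm'_eq_lintegral_enorm, ← ENNReal.toReal_rpow]
  exact Real.rpow_le_rpow h3 h2 (by positivity)

lemma eLpNorm'_eq_ofReal_lpT {p : ℝ} (hp : 0 < p) {f : (Fin n → ℝ) → ℂ} (hf : Continuous f) :
    eLpNorm' f p (μT n) = ENNReal.ofReal (lpT n p f) := by
  have h1 : ∀ x, ENNReal.ofReal (‖f x‖ ^ p) = ‖f x‖ₑ ^ p := fun x => by
    rw [← ENNReal.ofReal_rpow_of_nonneg (norm_nonneg _) hp.le, ofReal_norm]
  have h2 : Integrable (fun x => ‖f x‖ ^ p) (μT n) :=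
    integrable_of_continuous (hf.norm.rpow_const fun _ => .inr hp.le)
  have h3 : ∀ x, 0 ≤ ‖f x‖ ^ p := fun x => by positivity
  rw [lpT, ← ENNReal.ofReal_rpow_of_nonneg (integral_nonneg h3) (by positivity),
    ofReal_integral_eq_lintegral_ofReal h2 (.of_forall h3), eLpNorm'_eq_lintegral_enorm]
  simp only [h1]

end Main

/-- **Theorem II.** Let `2 ≤ p < ∞`, `0 < ε < 1`, `k = [n/2]+1` and `1/p + 1/q = 1`.
If `a : 𝕋ⁿ × ℤⁿ → ℂ` satisfies `|Δ_ξ^α a(x,ξ)| ≤ C_α ⟨ξ⟩^{-(n/2)ε - (1-ε)|α|}` and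
`|∂_x^β a(x,ξ)| ≤ C_β ⟨ξ⟩^{-(n/2)ε}` for `|α|, |β| ≤ k`, then for every `q ≤ r ≤ p` the
operator `a(x,D) : L^p(𝕋ⁿ) → L^r(𝕋ⁿ)` is bounded. -/
theorem periodic_pseudodiff_Lp_to_Lr_bounded
    (n : ℕ) (hn : 1 ≤ n) (p q ε : ℝ)
    (hp2 : 2 ≤ p) (hε0 : 0 < ε) (hε1 : ε < 1) (hpq : 1 / p + 1 / q = 1)
    (a : (Fin n → ℝ) → (Fin n → ℤ) → ℂ)
    (ha_smooth : ∀ ξ, ContDiff ℝ (⊤ : ℕ∞) fun x => a x ξ)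
    (ha_per : ∀ ξ, Per fun x => a x ξ)
    (ha₁ : ∀ α : Fin n → ℕ, (∑ j, α j) ≤ n / 2 + 1 →
      ∃ C : ℝ, 0 < C ∧ ∀ (x : Fin n → ℝ) (ξ : Fin n → ℤ),
        ‖ddM α (a x) ξ‖ ≤ C * jb ξ ^ (-((n : ℝ) / 2) * ε - (1 - ε) * ∑ j, (α j : ℝ)))
    (ha₂ : ∀ β : Fin n → ℕ, (∑ j, β j) ≤ n / 2 + 1 →
      ∃ C : ℝ, 0 < C ∧ ∀ (x : Fin n → ℝ) (ξ : Fin n → ℤ),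
        ‖pdM β (fun x' => a x' ξ) x‖ ≤ C * jb ξ ^ (-((n : ℝ) / 2) * ε)) :
    ∀ r : ℝ, q ≤ r → r ≤ p →
      ∃ C : ℝ, 0 < C ∧ ∀ f : (Fin n → ℝ) → ℂ, ContDiff ℝ (⊤ : ℕ∞) f → Per f →
        lpT n r (Op a f) ≤ C * lpT n p f := by
  intro r hqr hrp
  have hp0 : 0 < p := by linarith
  have hq0 : 0 < q := by
    have h1 : 1 / p ≤ 1 / 2 := one_div_le_one_div_of_le two_pos hp2
    exact one_div_pos.1 (by linarith)
  have hr0 : 0 < r := hq0.trans_le hqr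
  have hn0 : (1 : ℝ) ≤ n := by exact_mod_cast hn
  set κ : ℝ := n / 2 * ε with hκ
  have hκ0 : 0 < κ := by positivity
  have hk : n < 2 * (n / 2 + 1) := by omega
  obtain ⟨A, hA, ha_dd, ha_le, ha_pd⟩ := exists_symbol_bound hn (κ := κ) (δ := 1 - ε)
    (by simpa only [hκ, neg_mul] using ha₁) (by simpa only [hκ, neg_mul] using ha₂)
  obtain ⟨D, hD, φ, hsupp, hφ, hle, hone⟩ := exists_dyadic_partition n (n / 2 + 1)
  obtain ⟨E, hE, hdyad⟩ := exists_lintegral_dyadic_le hn hk hp2 hκ0.le (sub_nonneg.2 hε1.le)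
    (by linarith) (by rw [hκ]; ring) hA hD ha_smooth ha_per ha_dd ha_le ha_pd hsupp hφ
  set C : ℝ≥0∞ := E ^ (1 / p) * (1 - ENNReal.ofReal (2 ^ (-(2 * κ) / p)))⁻¹ with hC
  have hC_top : C ≠ ⊤ := by
    refine ENNReal.mul_ne_top (ENNReal.rpow_ne_top_of_nonneg (by positivity) hE)
      (ENNReal.inv_ne_top.2 (tsub_pos_of_lt ?_).ne')
    rw [ENNReal.ofReal_lt_one]
    exact Real.rpow_lt_one_of_one_lt_of_neg one_lt_two
      (div_neg_of_neg_of_pos (by linarith) hp0)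
  refine ⟨C.toReal + 1, by positivity, fun f hf hper => ?_⟩
  obtain ⟨B, -, hB⟩ := hper.exists_bound hf.continuous
  have hF : ∀ j, (φ j).support ⊆ dyadicBox n (n / 2 + 1) j := fun j ξ hξ =>
    mem_dyadicBox (t := 0) (l := ⟨0, hn⟩) (Nat.zero_le _) (by simpa using (hsupp j ξ hξ).1)
  have hT : ∀ j, Continuous
      (finOp (dyadicBox n (n / 2 + 1) j) (fun x ξ => φ j ξ * a x ξ) f) := fun j =>
    continuous_finOp _ (fun ξ => continuous_const.mul (ha_smooth ξ).continuous) f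
  have hS : ∀ J, Continuous (∑ j ∈ Finset.range J,
      finOp (dyadicBox n (n / 2 + 1) j) (fun x ξ => φ j ξ * a x ξ) f) := fun J => by
    have h := continuous_finsetSum (Finset.range J) fun j _ => hT j
    convert h using 1
    ext x
    simp
  have hmain : eLpNorm' (Op a f) r (μT n) ≤ C * eLpNorm' f p (μT n) := by
    refine eLpNorm'_le_of_tendsto_or_eq_zero hr0 (fun J => (hS (J + 1)).measurable) (fun x => ?_)
      fun J => ?_
    · by_cases hx : Summable fun ξ => eChar x ξ * a x ξ * fc f ξ
      · left
        simpa only [Finset.sum_apply] using tendsto_sum_finOp hF hle hone hx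
      · exact .inr (tsum_eq_zero_of_not_summable hx)
    · exact (eLpNorm'_le_eLpNorm'_of_exponent_le hr0 hrp _ (hS _).aestronglyMeasurable).trans
        (eLpNorm'_sum_le_of_geometric (by linarith) (fun j => (hT j).aestronglyMeasurable)
          (fun j => hdyad j f B hf.continuous.measurable hB) _)
  rw [eLpNorm'_eq_ofReal_lpT hp0 hf.continuous] at hmain
  have hlp : 0 ≤ lpT n p f := Real.rpow_nonneg (integral_nonneg fun x => by positivity) _
  have hfin : C * ENNReal.ofReal (lpT n p f) ≠ ⊤ := ENNReal.mul_ne_top hC_top ENNReal.ofReal_ne_top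
  calc lpT n r (Op a f) ≤ (eLpNorm' (Op a f) r (μT n)).toReal :=
        lpT_le_toReal_eLpNorm' hr0 _
    _ ≤ (C * ENNReal.ofReal (lpT n p f)).toReal := ENNReal.toReal_mono hfin hmain
    _ = C.toReal * lpT n p f := by rw [ENNReal.toReal_mul, ENNReal.toReal_ofReal hlp]
    _ ≤ (C.toReal + 1) * lpT n p f := by gcongr; linarith
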